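/- Every finite dimensional unitary representation of SL₄(ℤ) on a nonzero finite-dimensional complex inner product space contains a nonzero vector that is fixed by ρ(ι(g)) for every g ∈ SL₂(ℤ). -/

import Mathlib

open Matrix

/-- The embedding of SL₂ into SL₄ as the top-left block. -/
def iota {R : Type*} [CommRing R] (A : Matrix.SpecialLinearGroup (Fin 2) R) :
    Matrix.SpecialLinearGroup (Fin 4) R :=
  ⟨Matrix.reindex (finSumFinEquiv : Fin 2 ⊕ Fin 2 ≃ Fin 4)
      (finSumFinEquiv : Fin 2 ⊕ Fin 2 ≃ Fin 4) (Matrix.fromBlocks A.1 0 0 1),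
   by simp [Matrix.det_fromBlocks_zero₂₁, A.2]⟩


theorem csp_pow_eq_one {Q : Type*} [Group Q] (S : ℤ → ℤ → Q → Prop)
    (h1 : ∀ a b z, S a b z → ∀ t : ℤ, S (a + t * b) b z)
    (h3 : ∀ b z, S 1 b z → z = 1)
    (h4 : ∀ a b z, S a b z → ∀ m : ℕ, 0 < m → S (a ^ m) b (z ^ m))
    {a b : ℤ} {z : Q} (h : S a b z) (m : ℕ) (hm : 0 < m) (hd : b ∣ a ^ m - 1) : z ^ m = 1 := by
  obtain ⟨t, ht⟩ := hd
  have := h1 _ _ _ (h4 _ _ _ h m hm) (-t)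
  have e : a ^ m + -t * b = 1 := by linear_combination ht
  rw [e] at this
  exact h3 _ _ this

theorem csp_legendre (q r : ℕ) [Fact q.Prime] [Fact r.Prime] (hq : q % 4 = 3) (hr : r % 4 = 3)
    (h : legendreSym q r = 1) : (r : ℤ) ∣ (-(q : ℤ)) ^ ((r - 1) / 2) - 1 := by
  have e1 : legendreSym r (-(q : ℤ)) = 1 := by
    have : (-(q : ℤ)) = (-1) * q := by ring
    rw [this, legendreSym.mul, legendreSym.at_neg_one (by rintro rfl; omega),
      ZMod.χ₄_nat_three_mod_four hr, legendreSym.quadratic_reciprocity_three_mod_four hq hr, h]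
    norm_num
  have e2 := legendreSym.eq_pow r (-(q : ℤ))
  rw [e1] at e2
  have e3 : (r - 1) / 2 = r / 2 := by omega
  rw [e3, ← ZMod.intCast_eq_intCast_iff_dvd_sub]
  push_cast at e2 ⊢
  exact e2

theorem csp_trivial {Q : Type*} [Group Q] (n : ℕ) (hn : 0 < n) (S : ℤ → ℤ → Q → Prop)
    (hc : ∀ a b z, S a b z → IsCoprime a b)
    (ha : ∀ a b z, S a b z → (n : ℤ) ∣ a - 1)
    (hb : ∀ a b z, S a b z → (n : ℤ) ∣ b)
    (h1 : ∀ a b z, S a b z → ∀ t : ℤ, S (a + t * b) b z)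
    (h2 : ∀ a b z, S a b z → ∀ t : ℤ, S a (b + t * a * n) z)
    (h3 : ∀ b z, S 1 b z → z = 1)
    (h4 : ∀ a b z, S a b z → ∀ m : ℕ, 0 < m → S (a ^ m) b (z ^ m))
    (a b : ℤ) (z : Q) (h : S a b z) : z = 1 := by
  -- make b / n odd
  obtain ⟨b', hb', h⟩ : ∃ b' : ℤ, b' % 2 = 1 ∧ S a (n * b') z := by
    obtain ⟨b', rfl⟩ := hb _ _ _ h
    rcases Int.emod_two_eq_zero_or_one b' with h0 | h0
    · have hcop := hc _ _ _ h
      have haodd : a % 2 = 1 := by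
        rcases Int.emod_two_eq_zero_or_one a with h00 | h00
        · exfalso
          obtain ⟨k, hk⟩ := Int.dvd_of_emod_eq_zero h0
          obtain ⟨l, hl⟩ := Int.dvd_of_emod_eq_zero h00
          obtain ⟨u, v, huv⟩ := hcop
          rw [hk, hl] at huv
          have : 2 * (u * l + v * n * k) = 1 := by linear_combination huv
          omega
        · exact h00
      refine ⟨b' + a, by omega, ?_⟩
      have := h2 _ _ _ h 1
      convert this using 1
      ring
    · exact ⟨b', h0, h⟩
  -- make a = 1 mod 4
  obtain ⟨a, ha4, h⟩ : ∃ a : ℤ, a % 4 = 1 ∧ S a (n * b') z := by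
    have hcop := hc _ _ _ h
    have han := ha _ _ _ h
    have key : ∃ t : ℤ, (a + t * (n * b')) % 4 = 1 := by
      have hn4 : (n : ℤ) % 4 = 0 ∨ (n : ℤ) % 4 = 1 ∨ (n : ℤ) % 4 = 2 ∨ (n : ℤ) % 4 = 3 := by omega
      have hb4 : b' % 4 = 1 ∨ b' % 4 = 3 := by omega
      have hmod : ∀ t : ℤ, (a + t * (n * b')) % 4 = (a % 4 + (t % 4) * ((n % 4 : ℤ) * (b' % 4))) % 4 := by
        intro t
        simp [Int.add_emod, Int.mul_emod]
      have ha4 : a % 4 = 0 ∨ a % 4 = 1 ∨ a % 4 = 2 ∨ a % 4 = 3 := by omega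
      have c0 : (n : ℤ) % 4 = 0 → a % 4 = 1 := by
        intro h0
        have : (4 : ℤ) ∣ a - 1 := (Int.dvd_of_emod_eq_zero h0).trans han
        omega
      have c2 : (n : ℤ) % 4 = 2 → a % 2 = 1 := by
        intro h0
        have : (2 : ℤ) ∣ a - 1 := (show (2 : ℤ) ∣ n by omega).trans han
        omega
      rcases hn4 with h0 | h0 | h0 | h0 <;> rcases hb4 with h5 | h5 <;>
        rcases ha4 with h6 | h6 | h6 | h6 <;>
        first
        | (exact ⟨0, by rw [hmod, h0, h5, h6]; rfl⟩)
        | (exact ⟨1, by rw [hmod, h0, h5, h6]; rfl⟩)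
        | (exact ⟨2, by rw [hmod, h0, h5, h6]; rfl⟩)
        | (exact ⟨3, by rw [hmod, h0, h5, h6]; rfl⟩)
        | (exfalso; omega)
    obtain ⟨t, ht⟩ := key
    exact ⟨_, ht, h1 _ _ _ h t⟩
  have hb0 : b' ≠ 0 := by rintro rfl; simp at hb'
  have hnb : (n * b' : ℤ) ≠ 0 := mul_ne_zero (by exact_mod_cast hn.ne') hb0
  -- make a = -q
  obtain ⟨q, hqp, hq4, h⟩ : ∃ q : ℕ, q.Prime ∧ q % 4 = 3 ∧ S (-(q : ℤ)) (n * b') z := by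
    have hcop : IsCoprime (-a) ((4 * (n * b' : ℤ).natAbs : ℕ) : ℤ) := by
      push_cast
      apply IsCoprime.neg_left
      apply IsCoprime.mul_right
      · have : IsCoprime a 2 := by
          refine ⟨1, -(a / 2), ?_⟩
          omega
        simpa using this.pow_right (n := 2)
      · have := hc _ _ _ h
        rcases abs_choice (n * b' : ℤ) with h5 | h5 <;> rw [h5]
        · exact this
        · exact this.neg_right
    obtain ⟨q, -, hqp, hq⟩ := Nat.forall_exists_prime_gt_and_zmodEq 0
      (by simpa using hnb) hcop
    obtain ⟨k, hk⟩ := hq.dvd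
    have h4q : (q : ℤ) % 4 = 3 := by
      push_cast at hk
      rw [mul_assoc] at hk
      omega
    refine ⟨q, hqp, by omega, ?_⟩
    obtain ⟨l, hl⟩ : (n * b' : ℤ) ∣ -a - q := by
      rw [hk]
      push_cast
      exact Dvd.dvd.mul_right (Dvd.dvd.mul_left ((self_dvd_abs _)) 4) _
    have := h1 _ _ _ h l
    convert this using 1
    linear_combination hl
  have : Fact q.Prime := ⟨hqp⟩
  have hnq := ha _ _ _ h
  have hqb : IsCoprime (q : ℤ) b' := by
    have := hc _ _ _ h
    exact ((IsCoprime.neg_left_iff _ _).1 this).of_mul_right_right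
  -- choose the sign
  obtain ⟨b1, hb1, hqb1, hS1, hL⟩ : ∃ b1 : ℤ, ∃ ε : ℤ, IsCoprime (q : ℤ) b1 ∧
      (∀ r : ℤ, r ≡ b1 [ZMOD q] → S (-(q : ℤ)) (n * (ε * r)) z) ∧ legendreSym q b1 = 1 ∧
      (ε = 1 ∨ ε = -1) := by
    have hne : ((b' : ℤ) : ZMod q) ≠ 0 := by
      intro h0
      rw [ZMod.intCast_zmod_eq_zero_iff_dvd] at h0
      have := Int.isUnit_iff.1 (hqb.isUnit_of_dvd' dvd_rfl h0)
      have := hqp.two_le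
      omega
    have hshift : ∀ r : ℤ, r ≡ b' [ZMOD q] → S (-(q : ℤ)) (n * r) z := by
      intro r hr
      obtain ⟨k, hk⟩ := hr.dvd
      have := h2 _ _ _ h k
      convert this using 1
      linear_combination (-(n : ℤ)) * hk
    rcases legendreSym.eq_one_or_neg_one q hne with hl | hl
    · exact ⟨b', 1, hqb, by simpa using hshift, hl, Or.inl rfl⟩
    · refine ⟨-b', -1, hqb.neg_right, ?_, ?_, Or.inr rfl⟩
      · intro r hr
        have := hshift (-r) (by simpa using hr.neg)
        simpa using this
      · have : -b' = (-1) * b' := by ring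
        rw [this, legendreSym.mul, hl, legendreSym.at_neg_one (by rintro rfl; omega),
          ZMod.χ₄_nat_three_mod_four hq4]
        norm_num
  obtain ⟨hL, hε⟩ := hL
  by_cases hone : (1 : ℤ) ≡ b1 [ZMOD q]
  · have hs := hS1 1 hone
    obtain ⟨k, hk⟩ := hnq
    have := h1 _ _ _ hs (-(k * hb1))
    apply h3 _ _
    convert this using 1
    have : hb1 * hb1 = 1 := by rcases hε with rfl | rfl <;> norm_num
    linear_combination (-1) * hk + k * n * this
  -- divisibility helper
  have hdiv : ∀ (r m : ℕ), r.Prime → n < r → (r : ℤ) ∣ (-(q : ℤ)) ^ m - 1 →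
      (n * (hb1 * r) : ℤ) ∣ (-(q : ℤ)) ^ m - 1 := by
    intro r m hr hnr hd
    have c : IsCoprime (n : ℤ) (r : ℤ) := by
      rw [Nat.isCoprime_iff_coprime, Nat.coprime_comm]
      exact (Nat.Prime.coprime_iff_not_dvd hr).2 (Nat.not_dvd_of_pos_of_lt hn hnr)
    have d1 : (n : ℤ) ∣ (-(q : ℤ)) ^ m - 1 := hnq.trans (sub_one_dvd_pow_sub_one _ _)
    have := c.mul_dvd d1 hd
    rcases hε with h5 | h5 <;> rw [h5] <;> simpa using this
  -- first r
  obtain ⟨r, hrn, hrp, hr⟩ : ∃ r > n, r.Prime ∧ r % 4 = 3 ∧ (r : ℤ) ≡ b1 [ZMOD q] := by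
    obtain ⟨c, hc1, hc2⟩ : ∃ c : ℤ, c ≡ b1 [ZMOD q] ∧ c ≡ 3 [ZMOD 4] := by
      have : IsCoprime (q : ℤ) 4 := by
        have : IsCoprime (q : ℤ) 2 := ⟨1, -(q / 2), by omega⟩
        simpa using this.pow_right (n := 2)
      obtain ⟨u, v, huv⟩ := this
      refine ⟨b1 * (v * 4) + 3 * (u * q), ?_, ?_⟩
      · apply Int.modEq_iff_dvd.2
        exact ⟨b1 * u - 3 * u, by linear_combination (-b1) * huv⟩
      · apply Int.modEq_iff_dvd.2
        exact ⟨3 * v - b1 * v, by linear_combination (-3) * huv⟩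
    have hcop : IsCoprime c ((q * 4 : ℕ) : ℤ) := by
      push_cast
      apply IsCoprime.mul_right
      · obtain ⟨k, hk⟩ := hc1.dvd
        have e : c = b1 + (q : ℤ) * (-k) := by linear_combination (-1) * hk
        rw [e]
        exact hqb1.symm.add_mul_left_left _
      · obtain ⟨k, hk⟩ := hc2.dvd
        exact ⟨-1, 1 - k, by linear_combination hk⟩
    obtain ⟨r, h5, h6, h7⟩ := Nat.forall_exists_prime_gt_and_zmodEq n
      (by have := hqp.pos; omega) hcop
    push_cast at h7
    refine ⟨r, h5, h6, ?_, (h7.of_mul_right _).trans hc1⟩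
    have := (h7.of_mul_left _).trans hc2
    have := this.dvd
    omega
  obtain ⟨hr4, hrb⟩ := hr
  have : Fact r.Prime := ⟨hrp⟩
  have hLr : legendreSym q r = 1 := by
    rw [legendreSym.mod, hrb, ← legendreSym.mod, hL]
  have hm0 : 0 < (r - 1) / 2 := by omega
  have z1 : z ^ ((r - 1) / 2) = 1 := by
    refine csp_pow_eq_one S h1 h3 h4 (hS1 _ hrb) _ hm0 ?_
    exact hdiv r _ hrp hrn (csp_legendre q r hq4 hr4 hLr)
  set m := (r - 1) / 2 with hm
  -- second prime
  obtain ⟨s, hsn, hsp, hsq, hsb, hsm⟩ : ∃ s : ℕ, n < s ∧ s.Prime ∧ q < s ∧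
      (s : ℤ) ≡ b1 [ZMOD q] ∧ (s : ℤ) ≡ -1 [ZMOD m] := by
    have hqm : IsCoprime (q : ℤ) (m : ℤ) := by
      rw [Nat.isCoprime_iff_coprime]
      refine (Nat.Prime.coprime_iff_not_dvd hqp).2 ?_
      rintro ⟨k, hk⟩
      apply hone
      refine Int.ModEq.trans ?_ hrb
      apply Int.modEq_iff_dvd.2
      have : (r : ℤ) - 1 = 2 * m := by omega
      rw [this, hk]
      push_cast
      exact ⟨2 * k, by ring⟩
    obtain ⟨c, hc1, hc2⟩ : ∃ c : ℤ, c ≡ b1 [ZMOD q] ∧ c ≡ -1 [ZMOD m] := by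
      obtain ⟨u, v, huv⟩ := hqm
      refine ⟨b1 * (v * m) + -1 * (u * q), ?_, ?_⟩
      · apply Int.modEq_iff_dvd.2
        exact ⟨b1 * u + u, by linear_combination (-b1) * huv⟩
      · apply Int.modEq_iff_dvd.2
        exact ⟨- v - b1 * v, by linear_combination (1) * huv⟩
    have hcop : IsCoprime c ((q * m : ℕ) : ℤ) := by
      push_cast
      apply IsCoprime.mul_right
      · obtain ⟨k, hk⟩ := hc1.dvd
        have e : c = b1 + (q : ℤ) * (-k) := by linear_combination (-1) * hk
        rw [e]
        exact hqb1.symm.add_mul_left_left _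
      · obtain ⟨k, hk⟩ := hc2.dvd
        exact ⟨-1, - k, by linear_combination hk⟩
    obtain ⟨r, h5, h6, h7⟩ := Nat.forall_exists_prime_gt_and_zmodEq (max n q)
      (by have := hqp.pos; positivity) hcop
    push_cast at h7
    exact ⟨r, by omega, h6, by omega, (h7.of_mul_right _).trans hc1, (h7.of_mul_left _).trans hc2⟩
  have z2 : z ^ (s - 1) = 1 := by
    refine csp_pow_eq_one S h1 h3 h4 (hS1 _ hsb) _ (by have := hsp.two_le; omega) ?_
    apply hdiv s _ hsp hsn
    apply Int.ModEq.dvd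
    refine (Int.ModEq.pow_card_sub_one_eq_one hsp ?_).symm
    apply IsCoprime.neg_left
    rw [Nat.isCoprime_iff_coprime, Nat.coprime_comm]
    exact (Nat.Prime.coprime_iff_not_dvd hsp).2 (Nat.not_dvd_of_pos_of_lt hqp.pos hsq)
  have hcop : Nat.Coprime m (s - 1) := by
    rw [← Nat.isCoprime_iff_coprime]
    obtain ⟨k, hk⟩ := hsm.dvd
    have hs1 : ((s - 1 : ℕ) : ℤ) = s - 1 := by have := hsp.two_le; omega
    rw [hs1]
    have e : (s : ℤ) - 1 = -2 + m * (-k) := by linear_combination (-1) * hk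
    rw [e]
    apply IsCoprime.add_mul_left_right
    apply IsCoprime.neg_right
    refine ⟨1, -(m / 2), ?_⟩
    omega
  have := Nat.dvd_gcd (orderOf_dvd_of_pow_eq_one z1) (orderOf_dvd_of_pow_eq_one z2)
  rw [hcop.gcd_eq_one, Nat.dvd_one, orderOf_eq_one_iff] at this
  exact this

/-- Steinberg relations for a family indexed by pairs of indices and integers. -/
structure Stein {M : Type*} [Monoid M] (x : Fin 4 → Fin 4 → ℤ → M) : Prop where
  zero : ∀ i j, i ≠ j → x i j 0 = 1
  add : ∀ i j, i ≠ j → ∀ a b, x i j (a + b) = x i j a * x i j b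
  comm : ∀ i j k l, i ≠ j → k ≠ l → j ≠ k → i ≠ l → ∀ a b,
    x i j a * x k l b = x k l b * x i j a
  br : ∀ i j k, i ≠ j → j ≠ k → i ≠ k → ∀ a b,
    x i j a * x j k b = x i k (a * b) * x j k b * x i j a

/-- Elementary matrices. -/
def el (i j : Fin 4) (a : ℤ) : Matrix.SpecialLinearGroup (Fin 4) ℤ :=
  if h : i ≠ j then Matrix.SpecialLinearGroup.transvection h a else 1

theorem el_coe {i j : Fin 4} (h : i ≠ j) (a : ℤ) :
    (el i j a : Matrix (Fin 4) (Fin 4) ℤ) = 1 + Matrix.single i j a := by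
  simp [el, h, Matrix.SpecialLinearGroup.transvection_coe, Matrix.transvection]

theorem el_stein : Stein el where
  zero i j h := by
    apply Subtype.ext
    rw [el_coe h]; simp
  add i j h a b := by
    apply Subtype.ext
    rw [Matrix.SpecialLinearGroup.coe_mul, el_coe h, el_coe h, el_coe h]
    simp [mul_add, add_mul, Matrix.single_add, Matrix.single_mul_single_of_ne _ _ _ _ h.symm]
    abel
  comm i j k l h1 h2 h3 h4 a b := by
    apply Subtype.ext
    rw [Matrix.SpecialLinearGroup.coe_mul, Matrix.SpecialLinearGroup.coe_mul, el_coe h1, el_coe h2]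
    simp [mul_add, add_mul, Matrix.single_mul_single_of_ne _ _ _ _ h3,
      Matrix.single_mul_single_of_ne _ _ _ _ h4.symm]
    abel
  br i j k h1 h2 h3 a b := by
    apply Subtype.ext
    simp only [Matrix.SpecialLinearGroup.coe_mul, el_coe h1, el_coe h2, el_coe h3]
    simp [mul_add, add_mul, Matrix.single_mul_single_of_ne _ _ _ _ h3.symm,
      Matrix.single_mul_single_of_ne _ _ _ _ h1.symm, Matrix.single_mul_single_of_ne _ _ _ _ h2.symm]
    abel

/-- The elementary subgroup. -/
def El : Subgroup (Matrix.SpecialLinearGroup (Fin 4) ℤ) :=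
  Subgroup.closure {g | ∃ i j a, i ≠ j ∧ g = el i j a}

theorem el_mem (i j : Fin 4) (a : ℤ) : el i j a ∈ El := by
  by_cases h : i ≠ j
  · exact Subgroup.subset_closure ⟨i, j, a, h, rfl⟩
  · simp only [el, h]
    exact El.one_mem

/-- Elementary matrices as elements of the elementary subgroup. -/
def xe (i j : Fin 4) (a : ℤ) : El := ⟨el i j a, el_mem i j a⟩

theorem xe_stein : Stein xe where
  zero i j h := Subtype.ext (el_stein.zero i j h)
  add i j h a b := Subtype.ext (el_stein.add i j h a b)
  comm i j k l h1 h2 h3 h4 a b := Subtype.ext (el_stein.comm i j k l h1 h2 h3 h4 a b)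
  br i j k h1 h2 h3 a b := Subtype.ext (el_stein.br i j k h1 h2 h3 a b)

theorem xe_closure : Subgroup.closure {g | ∃ i j a, i ≠ j ∧ g = xe i j a} = ⊤ := by
  have h := Subgroup.closure_closure_coe_preimage
    (k := {g : Matrix.SpecialLinearGroup (Fin 4) ℤ | ∃ i j a, i ≠ j ∧ g = el i j a})
  rw [eq_top_iff]
  refine le_trans (le_of_eq h.symm) ?_
  apply Subgroup.closure_mono
  rintro x ⟨i, j, a, hij, hx⟩
  exact ⟨i, j, a, hij, Subtype.ext hx⟩

theorem iota_coe (A : Matrix.SpecialLinearGroup (Fin 2) ℤ) :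
    (iota A : Matrix (Fin 4) (Fin 4) ℤ) =
      !![A 0 0, A 0 1, 0, 0; A 1 0, A 1 1, 0, 0; 0, 0, 1, 0; 0, 0, 0, 1] := by
  ext i j
  fin_cases i <;> fin_cases j <;> rfl

theorem iota_mul (A B : Matrix.SpecialLinearGroup (Fin 2) ℤ) : iota (A * B) = iota A * iota B := by
  apply Subtype.ext
  rw [Matrix.SpecialLinearGroup.coe_mul, iota_coe, iota_coe, iota_coe]
  ext i j
  fin_cases i <;> fin_cases j <;> simp [Matrix.mul_apply, Fin.sum_univ_succ]

theorem el_coe' {i j : Fin 4} (h : i ≠ j) (a : ℤ) :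
    (el i j a : Matrix (Fin 4) (Fin 4) ℤ) =
      Matrix.of fun k l => if k = i ∧ l = j then a else if k = l then 1 else 0 := by
  rw [el_coe h]
  ext k l
  simp only [Matrix.add_apply, Matrix.single_apply, Matrix.one_apply, Matrix.of_apply]
  by_cases h1 : k = i
  · by_cases h2 : l = j
    · subst h1 h2; simp [h]
    · simp [h1, h2, Ne.symm h2]
  · simp [h1, Ne.symm h1]

theorem el01 (a : ℤ) : (el 0 1 a : Matrix (Fin 4) (Fin 4) ℤ) =
    !![1, a, 0, 0; 0, 1, 0, 0; 0, 0, 1, 0; 0, 0, 0, 1] := by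
  rw [el_coe' (by decide)]; ext i j; fin_cases i <;> fin_cases j <;> simp
theorem el10 (a : ℤ) : (el 1 0 a : Matrix (Fin 4) (Fin 4) ℤ) =
    !![1, 0, 0, 0; a, 1, 0, 0; 0, 0, 1, 0; 0, 0, 0, 1] := by
  rw [el_coe' (by decide)]; ext i j; fin_cases i <;> fin_cases j <;> simp
theorem el02 (a : ℤ) : (el 0 2 a : Matrix (Fin 4) (Fin 4) ℤ) =
    !![1, 0, a, 0; 0, 1, 0, 0; 0, 0, 1, 0; 0, 0, 0, 1] := by
  rw [el_coe' (by decide)]; ext i j; fin_cases i <;> fin_cases j <;> simp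
theorem el12 (a : ℤ) : (el 1 2 a : Matrix (Fin 4) (Fin 4) ℤ) =
    !![1, 0, 0, 0; 0, 1, a, 0; 0, 0, 1, 0; 0, 0, 0, 1] := by
  rw [el_coe' (by decide)]; ext i j; fin_cases i <;> fin_cases j <;> simp
theorem el20 (a : ℤ) : (el 2 0 a : Matrix (Fin 4) (Fin 4) ℤ) =
    !![1, 0, 0, 0; 0, 1, 0, 0; a, 0, 1, 0; 0, 0, 0, 1] := by
  rw [el_coe' (by decide)]; ext i j; fin_cases i <;> fin_cases j <;> simp
theorem el21 (a : ℤ) : (el 2 1 a : Matrix (Fin 4) (Fin 4) ℤ) =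
    !![1, 0, 0, 0; 0, 1, 0, 0; 0, a, 1, 0; 0, 0, 0, 1] := by
  rw [el_coe' (by decide)]; ext i j; fin_cases i <;> fin_cases j <;> simp

/-- Upper unipotent. -/
def up (t : ℤ) : Matrix.SpecialLinearGroup (Fin 2) ℤ := ⟨!![1, t; 0, 1], by simp⟩
/-- Lower unipotent. -/
def lo (t : ℤ) : Matrix.SpecialLinearGroup (Fin 2) ℤ := ⟨!![1, 0; t, 1], by simp⟩

theorem iota_up (t : ℤ) : iota (up t) = el 0 1 t := by
  apply Subtype.ext
  rw [iota_coe, el01]; simp [up]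

theorem iota_lo (t : ℤ) : iota (lo t) = el 1 0 t := by
  apply Subtype.ext
  rw [iota_coe, el10]; simp [lo]

theorem sl2_closure : Subgroup.closure ({up 1, lo 1} : Set (Matrix.SpecialLinearGroup (Fin 2) ℤ)) = ⊤ := by
  rw [eq_top_iff, ← SpecialLinearGroup.SL2Z_generators, Subgroup.closure_le]
  have hu : up 1 ∈ Subgroup.closure ({up 1, lo 1} : Set (Matrix.SpecialLinearGroup (Fin 2) ℤ)) :=
    Subgroup.subset_closure (by simp)
  have hl : lo 1 ∈ Subgroup.closure ({up 1, lo 1} : Set (Matrix.SpecialLinearGroup (Fin 2) ℤ)) :=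
    Subgroup.subset_closure (by simp)
  rintro g (rfl | rfl)
  · have h0 : up (-1) = (up 1)⁻¹ := by
      rw [eq_inv_iff_mul_eq_one]
      apply Subtype.ext
      show !![1, -1; 0, 1] * !![1, 1; 0, 1] = (1 : Matrix (Fin 2) (Fin 2) ℤ)
      decide
    have : ModularGroup.S = up (-1) * lo 1 * up (-1) := by
      apply Subtype.ext
      show !![0, -1; 1, 0] = (!![1, -1; 0, 1] * !![1, 0; 1, 1] * !![1, -1; 0, 1] : Matrix (Fin 2) (Fin 2) ℤ)
      decide
    rw [this, h0]
    exact mul_mem (mul_mem (inv_mem hu) hl) (inv_mem hu)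
  · have : ModularGroup.T = up 1 := by
      ext i j
      fin_cases i <;> fin_cases j <;> simp [ModularGroup.T, up]
    rw [this]
    exact hu

/-- `iota` as a homomorphism. -/
def iotaHom : Matrix.SpecialLinearGroup (Fin 2) ℤ →* Matrix.SpecialLinearGroup (Fin 4) ℤ :=
  MonoidHom.mk' iota iota_mul

theorem iota_mem (g : Matrix.SpecialLinearGroup (Fin 2) ℤ) : iota g ∈ El := by
  have h : Subgroup.closure ({up 1, lo 1} : Set (Matrix.SpecialLinearGroup (Fin 2) ℤ)) ≤
      El.comap iotaHom := by
    rw [Subgroup.closure_le]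
    rintro g (rfl | rfl)
    · show iota _ ∈ El
      rw [iota_up]; exact el_mem _ _ _
    · show iota _ ∈ El
      rw [iota_lo]; exact el_mem _ _ _
  rw [sl2_closure] at h
  exact h (Subgroup.mem_top g)

/-- `iota` into the elementary subgroup. -/
def ie : Matrix.SpecialLinearGroup (Fin 2) ℤ →* El :=
  MonoidHom.mk' (fun g => ⟨iota g, iota_mem g⟩) (fun a b => Subtype.ext (iota_mul a b))

theorem ie_up (t : ℤ) : ie (up t) = xe 0 1 t := Subtype.ext (iota_up t)
theorem ie_lo (t : ℤ) : ie (lo t) = xe 1 0 t := Subtype.ext (iota_lo t)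

theorem det2 (g : Matrix.SpecialLinearGroup (Fin 2) ℤ) : g 0 0 * g 1 1 - g 0 1 * g 1 0 = 1 := by
  have := g.2
  rwa [Matrix.det_fin_two] at this

theorem ie_conj02 (g : Matrix.SpecialLinearGroup (Fin 2) ℤ) (t : ℤ) :
    ie g * xe 0 2 t = xe 0 2 (g 0 0 * t) * xe 1 2 (g 1 0 * t) * ie g := by
  apply Subtype.ext; apply Subtype.ext
  show ((iota g * el 0 2 t : Matrix.SpecialLinearGroup (Fin 4) ℤ) : Matrix (Fin 4) (Fin 4) ℤ) =
    (el 0 2 (g 0 0 * t) * el 1 2 (g 1 0 * t) * iota g : Matrix.SpecialLinearGroup (Fin 4) ℤ)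
  simp only [Matrix.SpecialLinearGroup.coe_mul, iota_coe, el02, el12]
  ext i j
  fin_cases i <;> fin_cases j <;> simp [Matrix.mul_apply, Fin.sum_univ_succ]

theorem ie_conj12 (g : Matrix.SpecialLinearGroup (Fin 2) ℤ) (t : ℤ) :
    ie g * xe 1 2 t = xe 0 2 (g 0 1 * t) * xe 1 2 (g 1 1 * t) * ie g := by
  apply Subtype.ext; apply Subtype.ext
  show ((iota g * el 1 2 t : Matrix.SpecialLinearGroup (Fin 4) ℤ) : Matrix (Fin 4) (Fin 4) ℤ) =
    (el 0 2 (g 0 1 * t) * el 1 2 (g 1 1 * t) * iota g : Matrix.SpecialLinearGroup (Fin 4) ℤ)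
  simp only [Matrix.SpecialLinearGroup.coe_mul, iota_coe, el02, el12]
  ext i j
  fin_cases i <;> fin_cases j <;> simp [Matrix.mul_apply, Fin.sum_univ_succ]

theorem ie_conj20 (g : Matrix.SpecialLinearGroup (Fin 2) ℤ) (t : ℤ) :
    xe 2 0 t * ie g = ie g * (xe 2 0 (t * g 0 0) * xe 2 1 (t * g 0 1)) := by
  apply Subtype.ext; apply Subtype.ext
  show ((el 2 0 t * iota g : Matrix.SpecialLinearGroup (Fin 4) ℤ) : Matrix (Fin 4) (Fin 4) ℤ) =
    (iota g * (el 2 0 (t * g 0 0) * el 2 1 (t * g 0 1)) : Matrix.SpecialLinearGroup (Fin 4) ℤ)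
  simp only [Matrix.SpecialLinearGroup.coe_mul, iota_coe, el20, el21]
  ext i j
  fin_cases i <;> fin_cases j <;> simp [Matrix.mul_apply, Fin.sum_univ_succ]

theorem ie_conj21 (g : Matrix.SpecialLinearGroup (Fin 2) ℤ) (t : ℤ) :
    xe 2 1 t * ie g = ie g * (xe 2 0 (t * g 1 0) * xe 2 1 (t * g 1 1)) := by
  apply Subtype.ext; apply Subtype.ext
  show ((el 2 1 t * iota g : Matrix.SpecialLinearGroup (Fin 4) ℤ) : Matrix (Fin 4) (Fin 4) ℤ) =
    (iota g * (el 2 0 (t * g 1 0) * el 2 1 (t * g 1 1)) : Matrix.SpecialLinearGroup (Fin 4) ℤ)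
  simp only [Matrix.SpecialLinearGroup.coe_mul, iota_coe, el20, el21]
  ext i j
  fin_cases i <;> fin_cases j <;> simp [Matrix.mul_apply, Fin.sum_univ_succ]

/-- A Weyl element. -/
def we : El := xe 1 2 1 * xe 2 1 (-1) * xe 1 2 1

theorem we_coe : ((we : El) : Matrix.SpecialLinearGroup (Fin 4) ℤ).1 =
    !![1, 0, 0, 0; 0, 0, 1, 0; 0, -1, 0, 0; 0, 0, 0, 1] := by
  show ((el 1 2 1 * el 2 1 (-1) * el 1 2 1 : Matrix.SpecialLinearGroup (Fin 4) ℤ) :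
    Matrix (Fin 4) (Fin 4) ℤ) = _
  simp only [Matrix.SpecialLinearGroup.coe_mul, el21, el12]
  ext i j
  fin_cases i <;> fin_cases j <;> simp [Matrix.mul_apply, Fin.sum_univ_succ]

/-- Inverse of the Weyl element. -/
def we' : El := xe 1 2 (-1) * xe 2 1 1 * xe 1 2 (-1)

theorem we'_coe : ((we' : El) : Matrix.SpecialLinearGroup (Fin 4) ℤ).1 =
    !![1, 0, 0, 0; 0, 0, -1, 0; 0, 1, 0, 0; 0, 0, 0, 1] := by
  show ((el 1 2 (-1) * el 2 1 1 * el 1 2 (-1) : Matrix.SpecialLinearGroup (Fin 4) ℤ) :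
    Matrix (Fin 4) (Fin 4) ℤ) = _
  simp only [Matrix.SpecialLinearGroup.coe_mul, el21, el12]
  ext i j
  fin_cases i <;> fin_cases j <;> simp [Matrix.mul_apply, Fin.sum_univ_succ]

theorem we_mul : we * we' = 1 := by
  apply Subtype.ext; apply Subtype.ext
  show (we : Matrix.SpecialLinearGroup (Fin 4) ℤ).1 * (we' : Matrix.SpecialLinearGroup (Fin 4) ℤ).1 = 1
  rw [we_coe, we'_coe]
  ext i j
  fin_cases i <;> fin_cases j <;> simp [Matrix.mul_apply, Fin.sum_univ_succ]

theorem weyl_id : xe 2 1 1 * we * xe 2 1 1 = xe 1 2 1 := by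
  apply Subtype.ext; apply Subtype.ext
  show (el 2 1 1 : Matrix (Fin 4) (Fin 4) ℤ) * (we : Matrix.SpecialLinearGroup (Fin 4) ℤ).1 *
    (el 2 1 1 : Matrix (Fin 4) (Fin 4) ℤ) = (el 1 2 1 : Matrix (Fin 4) (Fin 4) ℤ)
  rw [we_coe, el21, el12]
  ext i j
  fin_cases i <;> fin_cases j <;> simp [Matrix.mul_apply, Fin.sum_univ_succ]

theorem mennicke_id (g1 g2 g : Matrix.SpecialLinearGroup (Fin 2) ℤ) (hb : g1 0 1 = g2 0 1)
    (ha : g 0 0 = g1 0 0 * g2 0 0) (hb' : g 0 1 = g1 0 1)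
    (hc : g 1 0 = g2 1 0 + g2 1 1 * g1 1 0 * g2 0 0) (hd : g 1 1 = g1 1 1 * g2 1 1) :
    ie g1 * (we * ie g2 * we') * xe 1 2 (g1 0 0) =
      xe 2 1 (g2 1 1) * we * (xe 2 0 (-(g1 1 1 * g2 1 0)) * xe 2 1 (g2 0 0)) * ie g := by
  apply Subtype.ext; apply Subtype.ext
  show (iota g1 : Matrix (Fin 4) (Fin 4) ℤ) * ((we : Matrix.SpecialLinearGroup (Fin 4) ℤ).1 *
    (iota g2 : Matrix (Fin 4) (Fin 4) ℤ) * (we' : Matrix.SpecialLinearGroup (Fin 4) ℤ).1) *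
    (el 1 2 (g1 0 0) : Matrix (Fin 4) (Fin 4) ℤ) =
    (el 2 1 (g2 1 1) : Matrix (Fin 4) (Fin 4) ℤ) * (we : Matrix.SpecialLinearGroup (Fin 4) ℤ).1 *
    ((el 2 0 (-(g1 1 1 * g2 1 0)) : Matrix (Fin 4) (Fin 4) ℤ) *
    (el 2 1 (g2 0 0) : Matrix (Fin 4) (Fin 4) ℤ)) * (iota g : Matrix (Fin 4) (Fin 4) ℤ)
  have d1 := det2 g1
  have d2 := det2 g2
  simp only [we_coe, we'_coe, iota_coe, el12, el21, el20, ha, hb', hc, hd]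
  rw [← hb] at d2 ⊢
  generalize g1 0 0 = a1 at *
  generalize g1 0 1 = b at *
  generalize g1 1 0 = c1 at *
  generalize g1 1 1 = d1 at *
  generalize g2 0 0 = a2 at *
  generalize g2 1 0 = c2 at *
  generalize g2 1 1 = d2 at *
  ext i j
  fin_cases i <;> fin_cases j <;> simp [Matrix.mul_apply, Fin.sum_univ_succ] <;> grind

theorem Stein.map {M N : Type*} [Monoid M] [Monoid N] {x : Fin 4 → Fin 4 → ℤ → M} (hx : Stein x)
    (f : M →* N) : Stein (fun i j a => f (x i j a)) where
  zero i j h := by simp [hx.zero i j h]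
  add i j h a b := by simp [hx.add i j h a b]
  comm i j k l h1 h2 h3 h4 a b := by
    simp only [← map_mul, hx.comm i j k l h1 h2 h3 h4 a b]
  br i j k h1 h2 h3 a b := by
    simp only [← map_mul, hx.br i j k h1 h2 h3 a b]

theorem Stein.mul_eq_one {M : Type*} [Monoid M] {x : Fin 4 → Fin 4 → ℤ → M} (hx : Stein x)
    {i j : Fin 4} (hij : i ≠ j) {n : ℤ} (h : x i j n = 1) (k : ℤ) : x i j (n * k) = 1 := by
  induction k using Int.induction_on with
  | zero => simpa using hx.zero i j hij
  | succ k ih => rw [mul_add, hx.add i j hij, ih, mul_one, h, one_mul]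
  | pred k ih =>
    have := hx.add i j hij (n * (-(k : ℤ) - 1)) n
    rw [h, mul_one] at this
    rw [← this, ← ih]
    congr 1; ring

theorem Stein.periodic {M : Type*} [Monoid M] {x : Fin 4 → Fin 4 → ℤ → M} (hx : Stein x)
    {i j : Fin 4} (hij : i ≠ j) {n : ℤ} (h : x i j n = 1) {a b : ℤ} (hab : n ∣ a - b) :
    x i j a = x i j b := by
  obtain ⟨k, hk⟩ := hab
  have : a = b + n * k := by linear_combination hk
  rw [this, hx.add i j hij, hx.mul_eq_one hij h, mul_one]

theorem sl2_mul (A B : Matrix.SpecialLinearGroup (Fin 2) ℤ) (i j : Fin 2) :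
    (A * B) i j = A i 0 * B 0 j + A i 1 * B 1 j := by
  rw [Matrix.SpecialLinearGroup.coe_mul, Matrix.mul_apply, Fin.sum_univ_two]
theorem up_apply (t : ℤ) (i j : Fin 2) : up t i j = !![1, t; 0, 1] i j := rfl
theorem lo_apply (t : ℤ) (i j : Fin 2) : lo t i j = !![1, 0; t, 1] i j := rfl

/-- Congruent to the identity. -/
def Cong1 (n : ℕ) (g : Matrix.SpecialLinearGroup (Fin 2) ℤ) : Prop :=
  (n : ℤ) ∣ g 0 0 - 1 ∧ (n : ℤ) ∣ g 0 1 ∧ (n : ℤ) ∣ g 1 0 ∧ (n : ℤ) ∣ g 1 1 - 1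

section
variable {Q : Type*} [Group Q]


theorem cc_per (π : El →* Q) (n : ℕ)
    (h : ∀ i j, i ≠ j → π (xe i j n) = 1)
    {i j : Fin 4} (hij : i ≠ j) {a b : ℤ} (hab : (n : ℤ) ∣ a - b) :
    π (xe i j a) = π (xe i j b) :=
  (xe_stein.map π).periodic hij (h i j hij) hab

theorem cc_one (π : El →* Q) (n : ℕ)
    (h : ∀ i j, i ≠ j → π (xe i j n) = 1)
    {i j : Fin 4} (hij : i ≠ j) {a : ℤ} (hab : (n : ℤ) ∣ a) :
    π (xe i j a) = 1 := by
  rw [cc_per π n h hij (b := 0) (by simpa using hab), xe_stein.zero i j hij, map_one]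

theorem cc_02 (π : El →* Q) (n : ℕ)
    (h : ∀ i j, i ≠ j → π (xe i j n) = 1)
    {g} (hg : Cong1 n g) (t : ℤ) : Commute (π (ie g)) (π (xe 0 2 t)) := by
  have := congrArg π (ie_conj02 g t)
  simp only [map_mul] at this
  rw [cc_per π n h (i := 0) (j := 2) (by decide) (a := g 0 0 * t) (b := t) (by
      have := hg.1.mul_right t; rwa [sub_mul, one_mul] at this),
    cc_one π n h (i := 1) (j := 2) (by decide) (hg.2.2.1.mul_right t), mul_one] at this
  exact this

theorem cc_12 (π : El →* Q) (n : ℕ)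
    (h : ∀ i j, i ≠ j → π (xe i j n) = 1)
    {g} (hg : Cong1 n g) (t : ℤ) : Commute (π (ie g)) (π (xe 1 2 t)) := by
  have := congrArg π (ie_conj12 g t)
  simp only [map_mul] at this
  rw [cc_per π n h (i := 1) (j := 2) (by decide) (a := g 1 1 * t) (b := t) (by
      have := hg.2.2.2.mul_right t; rwa [sub_mul, one_mul] at this),
    cc_one π n h (i := 0) (j := 2) (by decide) (hg.2.1.mul_right t), one_mul] at this
  exact this

theorem cc_20 (π : El →* Q) (n : ℕ)
    (h : ∀ i j, i ≠ j → π (xe i j n) = 1)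
    {g} (hg : Cong1 n g) (t : ℤ) : Commute (π (ie g)) (π (xe 2 0 t)) := by
  have := congrArg π (ie_conj20 g t)
  simp only [map_mul] at this
  rw [cc_per π n h (i := 2) (j := 0) (by decide) (a := t * g 0 0) (b := t) (by
      have := hg.1.mul_left t; rwa [mul_sub, mul_one] at this),
    cc_one π n h (i := 2) (j := 1) (by decide) (hg.2.1.mul_left t), mul_one] at this
  exact this.symm

theorem cc_21 (π : El →* Q) (n : ℕ)
    (h : ∀ i j, i ≠ j → π (xe i j n) = 1)
    {g} (hg : Cong1 n g) (t : ℤ) : Commute (π (ie g)) (π (xe 2 1 t)) := by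
  have := congrArg π (ie_conj21 g t)
  simp only [map_mul] at this
  rw [cc_per π n h (i := 2) (j := 1) (by decide) (a := t * g 1 1) (b := t) (by
      have := hg.2.2.2.mul_left t; rwa [mul_sub, mul_one] at this),
    cc_one π n h (i := 2) (j := 0) (by decide) (hg.2.2.1.mul_left t), one_mul] at this
  exact this.symm

theorem cc_10 (π : El →* Q) (n : ℕ)
    (h : ∀ i j, i ≠ j → π (xe i j n) = 1)
    {g} (hg : Cong1 n g) (t : ℤ) : Commute (π (ie g)) (π (xe 1 0 t)) := by
  have e : π (xe 1 0 t) = π (xe 1 2 t) * π (xe 2 0 1) * (π (xe 1 2 t))⁻¹ * (π (xe 2 0 1))⁻¹ := by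
    have := (xe_stein.map π).br 1 2 0 (by decide) (by decide) (by decide) t 1
    rw [mul_one] at this
    rw [this]; simp [mul_assoc]
  rw [e]
  exact (((cc_12 π n h hg t).mul_right (cc_20 π n h hg 1)).mul_right
    (cc_12 π n h hg t).inv_right).mul_right (cc_20 π n h hg 1).inv_right

theorem cc_we (π : El →* Q) (n : ℕ)
    (h : ∀ i j, i ≠ j → π (xe i j n) = 1)
    {g} (hg : Cong1 n g) : Commute (π (ie g)) (π we) := by
  rw [we, map_mul, map_mul]
  exact ((cc_12 π n h hg _).mul_right (cc_21 π n h hg _)).mul_right (cc_12 π n h hg _)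

theorem cc_mul (π : El →* Q) (n : ℕ)
    (h : ∀ i j, i ≠ j → π (xe i j n) = 1)
    {g1 g2 : Matrix.SpecialLinearGroup (Fin 2) ℤ} (h1 : Cong1 n g1) (h2 : Cong1 n g2)
    (hb : g1 0 1 = g2 0 1) :
    ∃ g, Cong1 n g ∧ g 0 0 = g1 0 0 * g2 0 0 ∧ g 0 1 = g1 0 1 ∧
      π (ie g) = π (ie g1) * π (ie g2) := by
  have d1 := det2 g1
  have d2 := det2 g2
  let g : Matrix.SpecialLinearGroup (Fin 2) ℤ :=
    ⟨!![g1 0 0 * g2 0 0, g1 0 1; g2 1 0 + g2 1 1 * g1 1 0 * g2 0 0, g1 1 1 * g2 1 1], by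
      rw [Matrix.det_fin_two_of]
      rw [← hb] at d2
      linear_combination d2 + g2 0 0 * g2 1 1 * d1⟩
  have hg : Cong1 n g := by
    obtain ⟨⟨p1, q1⟩, ⟨p2, q2⟩, ⟨p3, q3⟩, ⟨p4, q4⟩⟩ := h1
    obtain ⟨⟨r1, s1⟩, ⟨r2, s2⟩, ⟨r3, s3⟩, ⟨r4, s4⟩⟩ := h2
    refine ⟨⟨p1 * g2 0 0 + r1, ?_⟩, ⟨p2, q2⟩, ⟨r3 + g2 1 1 * p3 * g2 0 0, ?_⟩,
      ⟨p4 * g2 1 1 + r4, ?_⟩⟩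
    · show g1 0 0 * g2 0 0 - 1 = _
      linear_combination g2 0 0 * q1 + s1
    · show g2 1 0 + g2 1 1 * g1 1 0 * g2 0 0 = _
      linear_combination s3 + g2 1 1 * g2 0 0 * q3
    · show g1 1 1 * g2 1 1 - 1 = _
      linear_combination g2 1 1 * q4 + s4
  refine ⟨g, hg, rfl, rfl, ?_⟩
  have key := congrArg π (mennicke_id g1 g2 g hb rfl rfl rfl rfl)
  simp only [map_mul] at key
  rw [cc_per π n h (i := 1) (j := 2) (b := 1) (by decide) h1.1,
    cc_per π n h (i := 2) (j := 1) (b := 1) (by decide) h2.2.2.2,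
    cc_per π n h (i := 2) (j := 1) (b := 1) (by decide) h2.1,
    cc_one π n h (i := 2) (j := 0) (by decide) (by
      rw [dvd_neg]; exact h2.2.2.1.mul_left _), one_mul] at key
  have w1 := congrArg π weyl_id
  have w2 := congrArg π we_mul
  simp only [map_mul, map_one] at w1 w2
  rw [w1, ← (cc_we π n h h2).eq, mul_assoc (π (ie g2)), w2, mul_one,
    ← (cc_12 π n h hg 1).eq] at key
  exact (mul_right_cancel key).symm

theorem csp_main (π : El →* Q) (n : ℕ)
    (h : ∀ i j, i ≠ j → π (xe i j n) = 1)
    (hn : 0 < n) (g : Matrix.SpecialLinearGroup (Fin 2) ℤ) (hg : Cong1 n g) :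
    π (ie g) = 1 := by
  refine csp_trivial n hn (fun a b z => ∃ g, Cong1 n g ∧ g 0 0 = a ∧ g 0 1 = b ∧ π (ie g) = z)
    ?_ ?_ ?_ ?_ ?_ ?_ ?_ (g 0 0) (g 0 1) _ ⟨g, hg, rfl, rfl, rfl⟩
  · rintro a b z ⟨g, hg, rfl, rfl, rfl⟩
    exact ⟨g 1 1, -g 1 0, by linear_combination det2 g⟩
  · rintro a b z ⟨g, hg, rfl, rfl, rfl⟩
    exact hg.1
  · rintro a b z ⟨g, hg, rfl, rfl, rfl⟩
    exact hg.2.1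
  · rintro a b z ⟨g, hg, rfl, rfl, rfl⟩ t
    have e00 : (lo (-t) * g * lo t) 0 0 = g 0 0 + t * g 0 1 := by
      simp [sl2_mul, up_apply, lo_apply]; ring
    have e01 : (lo (-t) * g * lo t) 0 1 = g 0 1 := by
      simp [sl2_mul, up_apply, lo_apply]
    have e10 : (lo (-t) * g * lo t) 1 0 = -t * (g 0 0 + t * g 0 1) + g 1 0 + g 1 1 * t := by
      simp [sl2_mul, up_apply, lo_apply]; ring
    have e11 : (lo (-t) * g * lo t) 1 1 = -t * g 0 1 + g 1 1 := by
      simp [sl2_mul, up_apply, lo_apply]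
    refine ⟨lo (-t) * g * lo t, ?_, e00, e01, ?_⟩
    · obtain ⟨⟨p1, q1⟩, ⟨p2, q2⟩, ⟨p3, q3⟩, ⟨p4, q4⟩⟩ := hg
      refine ⟨⟨p1 + t * p2, ?_⟩, ⟨p2, ?_⟩, ⟨-t * p1 - t * t * p2 + p3 + p4 * t, ?_⟩,
        ⟨-t * p2 + p4, ?_⟩⟩
      · rw [e00]; linear_combination q1 + t * q2
      · rw [e01]; exact q2
      · rw [e10]; linear_combination -t * q1 - t * t * q2 + q3 + t * q4
      · rw [e11]; linear_combination -t * q2 + q4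
    · rw [map_mul, map_mul, map_mul, map_mul, ie_lo, ie_lo, mul_assoc, (cc_10 π n h hg t).eq,
        ← mul_assoc, ← map_mul, ← xe_stein.add 1 0 (by decide), neg_add_cancel,
        xe_stein.zero 1 0 (by decide), map_one, one_mul]
  · rintro a b z ⟨g, hg, rfl, rfl, rfl⟩ t
    have e00 : (g * up (t * n)) 0 0 = g 0 0 := by
      simp [sl2_mul, up_apply, lo_apply]
    have e01 : (g * up (t * n)) 0 1 = g 0 1 + t * g 0 0 * n := by
      simp [sl2_mul, up_apply, lo_apply]; ring
    have e10 : (g * up (t * n)) 1 0 = g 1 0 := by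
      simp [sl2_mul, up_apply, lo_apply]
    have e11 : (g * up (t * n)) 1 1 = g 1 1 + t * g 1 0 * n := by
      simp [sl2_mul, up_apply, lo_apply]; ring
    refine ⟨g * up (t * n), ?_, e00, e01, ?_⟩
    · obtain ⟨⟨p1, q1⟩, ⟨p2, q2⟩, ⟨p3, q3⟩, ⟨p4, q4⟩⟩ := hg
      refine ⟨⟨p1, ?_⟩, ⟨p2 + t * g 0 0, ?_⟩, ⟨p3, ?_⟩, ⟨p4 + t * g 1 0, ?_⟩⟩
      · rw [e00]; exact q1
      · rw [e01]; linear_combination q2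
      · rw [e10]; exact q3
      · rw [e11]; linear_combination q4
    · rw [map_mul, map_mul, ie_up, cc_one π n h (i := 0) (j := 1) (by decide)
        (Dvd.intro_left t rfl), mul_one]
  · rintro b z ⟨g, hg, h00, rfl, rfl⟩
    have e : g = lo (g 1 0) * up (g 0 1) := by
      have d := det2 g
      ext i j
      fin_cases i <;> fin_cases j <;>
        simp [sl2_mul, up_apply, lo_apply]
      · exact h00
      · rw [h00] at d
        linear_combination d
    rw [e, map_mul, map_mul, ie_up, ie_lo, cc_one π n h (i := 0) (j := 1) (by decide) hg.2.1,
      cc_one π n h (i := 1) (j := 0) (by decide) hg.2.2.1, mul_one]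
  · rintro a b z ⟨g, hg, rfl, rfl, rfl⟩ m hm
    induction m, hm using Nat.le_induction with
    | base => exact ⟨g, hg, by simp, rfl, by simp⟩
    | succ m hm ih =>
      obtain ⟨g', hg', h1, h2, h3⟩ := ih
      obtain ⟨g'', q1, q2, q3, q4⟩ := cc_mul π n h hg' hg h2
      exact ⟨g'', q1, by rw [q2, h1, pow_succ], by rw [q3, h2], by rw [q4, h3, pow_succ]⟩

end

section
variable {V : Type*} [NormedAddCommGroup V] [InnerProductSpace ℂ V] [FiniteDimensional ℂ V]

theorem exists_eig {E : Type*} [AddCommGroup E] [Module ℂ E] [FiniteDimensional ℂ E]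
    (T : Module.End ℂ E) (W : Submodule ℂ E) (hW : ∀ w ∈ W, T w ∈ W)
    (hne : W ≠ ⊥) : ∃ (l : ℂ) (w : E), w ∈ W ∧ w ≠ 0 ∧ T w = l • w := by
  haveI : Nontrivial W := Submodule.nontrivial_iff_ne_bot.2 hne
  obtain ⟨l, hl⟩ := Module.End.exists_eigenvalue (LinearMap.restrict T hW)
  obtain ⟨w, hw⟩ := hl.exists_hasEigenvector
  refine ⟨l, w, w.2, fun h => hw.2 (Subtype.ext h), ?_⟩
  have := hw.apply_eq_smul
  exact congrArg Subtype.val this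

theorem pow_eig {E : Type*} [AddCommGroup E] [Module ℂ E] {T : Module.End ℂ E} {l : ℂ} {w : E}
    (h : T w = l • w) (n : ℕ) : (T ^ n) w = l ^ n • w := by
  induction n with
  | zero => simp
  | succ n ih => rw [pow_succ', Module.End.mul_apply, ih, map_smul, h, smul_smul, pow_succ]

theorem lemD (T : Module.End ℂ V) (hT : ∀ x y, inner ℂ (T x) (T y) = inner ℂ x y)
    (W : Submodule ℂ V) (hW : ∀ w ∈ W, T w ∈ W) (N : ℕ) (hN : 0 < N)
    (hl : ∀ (l : ℂ) (w : V), w ∈ W → w ≠ 0 → T w = l • w → l ^ N = 1) :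
    ∀ w ∈ W, (T ^ N) w = w := by
  let K : Submodule ℂ V := W ⊓ LinearMap.ker (T ^ N - 1)
  have hK : ∀ w, w ∈ K ↔ w ∈ W ∧ (T ^ N) w = w := by
    intro w
    simp only [K, Submodule.mem_inf, LinearMap.mem_ker, LinearMap.sub_apply, Module.End.one_apply,
      sub_eq_zero]
  have hWp : ∀ n : ℕ, ∀ w ∈ W, (T ^ n) w ∈ W := by
    intro n
    induction n with
    | zero => simp
    | succ n ih => intro w hw; rw [pow_succ', Module.End.mul_apply]; exact hW _ (ih w hw)
  have hbot : W ⊓ Kᗮ = ⊥ := by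
    by_contra hne
    obtain ⟨l, w, hw, hw0, e⟩ := exists_eig T (W ⊓ Kᗮ) (by
      rintro w ⟨h1, h2⟩
      refine ⟨hW _ h1, ?_⟩
      rw [SetLike.mem_coe, Submodule.mem_orthogonal] at h2 ⊢
      intro u hu
      obtain ⟨hu1, hu2⟩ := (hK u).1 hu
      obtain ⟨M, rfl⟩ : ∃ M, N = M + 1 := ⟨N - 1, by omega⟩
      have : u = T ((T ^ M) u) := by
        rw [← Module.End.mul_apply, ← pow_succ', hu2]
      rw [this, hT]
      apply h2
      rw [hK]
      refine ⟨hWp _ _ hu1, ?_⟩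
      rw [← Module.End.mul_apply, ← pow_add, add_comm, pow_add, Module.End.mul_apply, hu2]) hne
    have hwK : w ∈ K := by
      rw [hK]
      refine ⟨hw.1, ?_⟩
      rw [pow_eig e, hl l w hw.1 hw0 e, one_smul]
    have := (Submodule.mem_orthogonal K w).1 hw.2 w hwK
    exact hw0 (inner_self_eq_zero.1 this)
  intro w hw
  obtain ⟨y, hy, z, hz, rfl⟩ := K.exists_add_mem_mem_orthogonal w
  have hzW : z ∈ W := by
    have := W.sub_mem hw ((hK y).1 hy).1
    simpa using this
  have : z ∈ W ⊓ Kᗮ := ⟨hzW, hz⟩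
  rw [hbot, Submodule.mem_bot] at this
  subst this
  rw [add_zero]
  exact ((hK y).1 hy).2

theorem Stein.pow {M : Type*} [Monoid M] {x : Fin 4 → Fin 4 → ℤ → M} (hx : Stein x)
    {i j : Fin 4} (hij : i ≠ j) (a : ℤ) (n : ℕ) : x i j a ^ n = x i j (a * n) := by
  induction n with
  | zero => simp [hx.zero i j hij]
  | succ n ih => rw [pow_succ, ih, ← hx.add i j hij]; congr 1; push_cast; ring

theorem third (i j : Fin 4) : ∃ k, i ≠ k ∧ k ≠ j := by
  revert i j; decide

theorem comm_eig {E : Type*} [AddCommGroup E] [Module ℂ E] [FiniteDimensional ℂ E]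
    (T A B : Module.End ℂ E) (hA : Function.Injective A) (hB : Function.Injective B)
    (hTA : A * T = T * A) (hTB : B * T = T * B) (h : A * B = T * B * A)
    (l : ℂ) (w : E) (hw : w ≠ 0) (e : T w = l • w) : l ^ (Module.finrank ℂ E).factorial = 1 := by
  let W := Module.End.eigenspace T l
  have hAW : ∀ w ∈ W, A w ∈ W := by
    intro w hw
    rw [Module.End.mem_eigenspace_iff] at hw ⊢
    rw [← Module.End.mul_apply, ← hTA, Module.End.mul_apply, hw, map_smul]
  have hBW : ∀ w ∈ W, B w ∈ W := by
    intro w hw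
    rw [Module.End.mem_eigenspace_iff] at hw ⊢
    rw [← Module.End.mul_apply, ← hTB, Module.End.mul_apply, hw, map_smul]
  let A' := LinearMap.restrict A hAW
  let B' := LinearMap.restrict B hBW
  have hAi : Function.Injective A' := fun x y h => Subtype.ext (hA (congrArg Subtype.val h))
  have hBi : Function.Injective B' := fun x y h => Subtype.ext (hB (congrArg Subtype.val h))
  have hdA : LinearMap.det A' ≠ 0 := by
    intro h0
    exact (LinearMap.bot_lt_ker_of_det_eq_zero h0).ne' (LinearMap.ker_eq_bot.2 hAi)
  have hdB : LinearMap.det B' ≠ 0 := by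
    intro h0
    exact (LinearMap.bot_lt_ker_of_det_eq_zero h0).ne' (LinearMap.ker_eq_bot.2 hBi)
  have hAB : A' ∘ₗ B' = l • (B' ∘ₗ A') := by
    ext ⟨x, hx⟩
    show A (B x) = l • B (A x)
    have h1 := congrArg (fun f : Module.End ℂ E => f x) h
    simp only [Module.End.mul_apply] at h1
    rw [h1]
    exact Module.End.mem_eigenspace_iff.1 (hBW _ (hAW _ hx))
  have hdet := congrArg LinearMap.det hAB
  rw [LinearMap.det_smul, LinearMap.det_comp, LinearMap.det_comp] at hdet
  have hp : l ^ Module.finrank ℂ W = 1 := by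
    have : (l ^ Module.finrank ℂ W - 1) * (LinearMap.det B' * LinearMap.det A') = 0 := by
      linear_combination -hdet
    rcases mul_eq_zero.1 this with h | h
    · exact sub_eq_zero.1 h
    · exact absurd h (mul_ne_zero hdB hdA)
  have hwW : w ∈ W := Module.End.mem_eigenspace_iff.2 e
  haveI : Nontrivial W := ⟨⟨⟨w, hwW⟩, 0, fun h => hw (congrArg Subtype.val h)⟩⟩
  have hpos : 0 < Module.finrank ℂ W := Module.finrank_pos
  obtain ⟨m, hm⟩ := Nat.dvd_factorial hpos (Submodule.finrank_le W)
  rw [hm, pow_mul, hp, one_pow]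

theorem finite_order {X : Fin 4 → Fin 4 → ℤ → Module.End ℂ V} (hX : Stein X)
    (hiso : ∀ i j a x y, inner ℂ (X i j a x) (X i j a y) = inner ℂ x y)
    (i j : Fin 4) (hij : i ≠ j) : X i j ((Module.finrank ℂ V).factorial : ℕ) = 1 := by
  obtain ⟨k, hik, hkj⟩ := third i j
  have hinj : ∀ i j a, Function.Injective (X i j a) := by
    intro i j a
    rw [← LinearMap.ker_eq_bot, LinearMap.ker_eq_bot']
    intro x hx
    have := hiso i j a x x
    rw [hx, inner_zero_left] at this
    exact inner_self_eq_zero.1 this.symm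
  have e : X i j ((Module.finrank ℂ V).factorial : ℕ) = X i j 1 ^ (Module.finrank ℂ V).factorial := by
    rw [hX.pow hij, one_mul]
  rw [e]
  ext w
  refine lemD (X i j 1) (hiso i j 1) ⊤ (fun _ _ => trivial) _ (Nat.factorial_pos _) ?_ w trivial
  intro l w _ hw0 hw
  refine comm_eig (X i j 1) (X i k 1) (X k j 1) (hinj _ _ _) (hinj _ _ _)
    (hX.comm i k i j hik hij hik.symm hij 1 1) (hX.comm k j i j hkj hij hij.symm hkj 1 1) ?_
    l w hw0 hw
  have := hX.br i k j hik hkj hij 1 1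
  rwa [one_mul] at this
end

theorem stable_aux (n : ℕ) (hn : 0 < n) (I d : ℤ) (h : IsCoprime d I) :
    ∃ s : ℤ, IsCoprime (d + s * I) n := by
  refine ⟨∏ p ∈ n.primeFactors with ¬ ((p : ℕ) : ℤ) ∣ d, (p : ℤ), ?_⟩
  rw [Int.isCoprime_iff_gcd_eq_one]
  by_contra hne
  obtain ⟨p, hp, h1, h2⟩ := Nat.Prime.not_coprime_iff_dvd.1 hne
  simp only [Int.natAbs_natCast] at h2
  rw [← Int.natCast_dvd] at h1
  have hpp : Prime (p : ℤ) := Nat.prime_iff_prime_int.1 hp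
  by_cases hd : (p : ℤ) ∣ d
  · rw [dvd_add_right hd] at h1
    rcases hpp.dvd_or_dvd h1 with h3 | h3
    · rw [hpp.dvd_finset_prod_iff] at h3
      obtain ⟨r, hr, hr2⟩ := h3
      rw [Finset.mem_filter, Nat.mem_primeFactors] at hr
      have : p = r := (Nat.prime_dvd_prime_iff_eq hp hr.1.1).1 (Int.natCast_dvd_natCast.1 hr2)
      exact hr.2 (this ▸ hd)
    · exact hpp.not_unit (h.isUnit_of_dvd' hd h3)
  · refine hd ((dvd_add_left ?_).1 h1)
    apply Dvd.dvd.mul_right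
    exact Finset.dvd_prod_of_mem (fun p : ℕ => (p : ℤ))
      (Finset.mem_filter.2 ⟨Nat.mem_primeFactors.2 ⟨hp, h2, hn.ne'⟩, hd⟩)

theorem stable_range (n : ℕ) (hn : 0 < n) (I d : ℤ) : ∃ s t : ℤ, (n : ℤ) ∣ I + t * (d + s * I) := by
  by_cases h0 : 0 < Int.gcd d I
  · obtain ⟨d', I', h1, h2, h3⟩ := Int.exists_gcd_one h0
    obtain ⟨s, u, w, hs⟩ := stable_aux n hn I' d' (Int.isCoprime_iff_gcd_eq_one.2 h1)
    set g : ℤ := (Int.gcd d I : ℤ)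
    refine ⟨s, -u * I', g * I' * w, ?_⟩
    rw [h2, h3]
    linear_combination -g * I' * hs
  · have : I = 0 := by
      have := Nat.eq_zero_of_not_pos h0
      exact (Int.gcd_eq_zero_iff.1 this).2
    exact ⟨0, 0, by simp [this]⟩

section
variable {E : Type*} [AddCommGroup E] [Module ℂ E] {X : Fin 4 → Fin 4 → ℤ → Module.End ℂ E}

/-- Joint eigenvector condition for a root subgroup. -/
def Eg (X : Fin 4 → Fin 4 → ℤ → Module.End ℂ E) (z : ℂ) (i j : Fin 4) (c : ℤ) (v : E) : Prop :=
  ∀ a : ℤ, X i j a v = z ^ (c * a) • v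

/-- Joint eigenspace. -/
def Es (X : Fin 4 → Fin 4 → ℤ → Module.End ℂ E) (z : ℂ) (i j : Fin 4) (c : ℤ) : Submodule ℂ E where
  carrier := {v | Eg X z i j c v}
  zero_mem' a := by simp
  add_mem' h1 h2 a := by rw [map_add, h1 a, h2 a, smul_add]
  smul_mem' r v h a := by rw [map_smul, h a, smul_comm]

theorem mem_Es {z : ℂ} {i j : Fin 4} {c : ℤ} {v : E} : v ∈ Es X z i j c ↔ Eg X z i j c v := Iff.rfl

theorem Stein.inv_apply (hX : Stein X) {i j : Fin 4} (hij : i ≠ j) (a : ℤ) (v : E) :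
    X i j (-a) (X i j a v) = v := by
  rw [← Module.End.mul_apply, ← hX.add i j hij, neg_add_cancel, hX.zero i j hij,
    Module.End.one_apply]

theorem Stein.ne_zero (hX : Stein X) {i j : Fin 4} (hij : i ≠ j) (a : ℤ) {v : E} (hv : v ≠ 0) :
    X i j a v ≠ 0 := by
  intro h
  have := hX.inv_apply hij a v
  rw [h, map_zero] at this
  exact hv this.symm

theorem Stein.eg_of_one (hX : Stein X) {i j : Fin 4} (hij : i ≠ j) {z : ℂ} (hz : z ≠ 0) {c : ℤ}
    {v : E} (h : X i j 1 v = z ^ c • v) : Eg X z i j c v := by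
  intro a
  induction a using Int.induction_on with
  | zero => simp [hX.zero i j hij]
  | succ k ih =>
    rw [hX.add i j hij, Module.End.mul_apply, h, map_smul, ih, smul_smul, ← zpow_add₀ hz]
    congr 2; ring
  | pred k ih =>
    have e : (-(k : ℤ)) = (-(k : ℤ) - 1) + 1 := by ring
    rw [e, hX.add i j hij, Module.End.mul_apply, h, map_smul] at ih
    have h2 : X i j (-(k : ℤ) - 1) v = z ^ (-c) • (z ^ c • X i j (-(k : ℤ) - 1) v) := by
      rw [smul_smul, ← zpow_add₀ hz]; simp
    rw [h2, ih, smul_smul, ← zpow_add₀ hz]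
    congr 2; ring

theorem eg_comm (hX : Stein X) {z : ℂ} {i j k l : Fin 4} (hij : i ≠ j) (hkl : k ≠ l) (hjk : j ≠ k)
    (hil : i ≠ l) (s : ℤ) {c : ℤ} {v : E} (h : Eg X z k l c v) : Eg X z k l c (X i j s v) := by
  intro a
  rw [← Module.End.mul_apply, ← hX.comm i j k l hij hkl hjk hil, Module.End.mul_apply, h a,
    map_smul]

theorem eg_row (hX : Stein X) {z : ℂ} (hz : z ≠ 0) {i j k : Fin 4} (hij : i ≠ j) (hki : k ≠ i)
    (hkj : k ≠ j) (s : ℤ) {c d : ℤ} {v : E} (h : Eg X z k i c v) (h' : Eg X z k j d v) :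
    Eg X z k i (c + s * d) (X i j s v) := by
  intro a
  rw [← Module.End.mul_apply, hX.br k i j hki hij hkj, Module.End.mul_apply, Module.End.mul_apply,
    h a, map_smul, map_smul, ← Module.End.mul_apply,
    hX.comm k j i j hkj hij hij.symm hkj, Module.End.mul_apply,
    h', map_smul, smul_smul, ← zpow_add₀ hz]
  congr 2; ring

theorem eg_col (hX : Stein X) {z : ℂ} (hz : z ≠ 0) {i j k : Fin 4} (hij : i ≠ j) (hjk : j ≠ k)
    (hik : i ≠ k) (s : ℤ) {c d : ℤ} {v : E} (h : Eg X z j k c v) (h' : Eg X z i k d v) :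
    Eg X z j k (c - s * d) (X i j s v) := by
  intro a
  have h1 : X i j s (X j k a v) = X i k (s * a) (X j k a (X i j s v)) := by
    rw [← Module.End.mul_apply, hX.br i j k hij hjk hik, Module.End.mul_apply, Module.End.mul_apply]
  have h2 : X j k a (X i j s v) = X i k (-(s * a)) (X i j s (X j k a v)) := by
    rw [h1, hX.inv_apply hik]
  rw [h2, h a, map_smul, map_smul, ← Module.End.mul_apply,
    hX.comm i k i j hik hij hik.symm hij, Module.End.mul_apply, h', map_smul, smul_smul,
    ← zpow_add₀ hz]
  congr 2; ring

theorem eg_congr {z : ℂ} {n : ℕ} (hz : IsPrimitiveRoot z n) {i j : Fin 4} {c d : ℤ} {v : E}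
    (hcd : (n : ℤ) ∣ c - d) (h : Eg X z i j c v) (hn : 0 < n) : Eg X z i j d v := by
  intro a
  rw [h a]
  obtain ⟨k, hk⟩ := hcd
  have : c * a = d * a + n * (k * a) := by linear_combination a * hk
  have hz0 := hz.ne_zero hn.ne'
  rw [this, zpow_add₀ hz0, zpow_mul z n, zpow_natCast, hz.pow_eq_one, _root_.one_zpow, mul_one]

theorem find_eg [FiniteDimensional ℂ E] (hX : Stein X) {z : ℂ} {n : ℕ} (hn : 0 < n)
    (hz : IsPrimitiveRoot z n)
    {i j : Fin 4} (hij : i ≠ j) (hXn : X i j n = 1) (W : Submodule ℂ E)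
    (hW : ∀ w ∈ W, X i j 1 w ∈ W) (hne : ∃ w ∈ W, w ≠ 0) :
    ∃ c : ℤ, ∃ w ∈ W ⊓ Es X z i j c, w ≠ 0 := by
  have hne' : W ≠ ⊥ := by
    obtain ⟨w, h1, h2⟩ := hne
    rintro rfl
    exact h2 ((Submodule.mem_bot ℂ).1 h1)
  obtain ⟨l, w, hw, hw0, e⟩ := exists_eig (X i j 1) W hW hne'
  have hl : l ^ n = 1 := by
    have := pow_eig e n
    rw [hX.pow hij, one_mul, hXn, Module.End.one_apply] at this
    have h2 : (l ^ n - 1) • w = 0 := by rw [sub_smul, ← this, one_smul, sub_self]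
    rcases smul_eq_zero.1 h2 with h | h
    · exact sub_eq_zero.1 h
    · exact absurd h hw0
  have : NeZero n := ⟨hn.ne'⟩
  obtain ⟨c, -, hc⟩ := hz.eq_pow_of_pow_eq_one hl
  refine ⟨c, w, ⟨hw, hX.eg_of_one hij (hz.ne_zero hn.ne') ?_⟩, hw0⟩
  rw [e, ← hc, zpow_natCast]

theorem localL [FiniteDimensional ℂ E] (hX : Stein X) {z : ℂ} {n : ℕ} (hn : 0 < n)
    (hz : IsPrimitiveRoot z n) (hXn : ∀ i j, i ≠ j → X i j n = 1) (v : E) (hv : v ≠ 0)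
    (h02 : X 0 2 1 v = z • v) :
    ∃ w : E, w ≠ 0 ∧ Eg X z 0 2 1 w ∧ Eg X z 1 2 0 w ∧ Eg X z 1 0 0 w := by
  have hz0 : z ≠ 0 := hz.ne_zero hn.ne'
  have a1 : Eg X z 0 2 1 v := hX.eg_of_one (by decide) hz0 (by rw [h02, zpow_one])
  obtain ⟨c, v1, ⟨hv1, hv1'⟩, hv10⟩ := find_eg hX hn hz (i := 1) (j := 2) (by decide)
    (hXn 1 2 (by decide)) (Es X z 0 2 1)
    (fun w hw => eg_comm hX (by decide) (by decide) (by decide) (by decide) _ hw) ⟨v, a1, hv⟩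
  let V1 := Es X z 0 2 1 ⊓ Es X z 1 2 0
  have b1 : X 0 1 c v1 ∈ V1 := by
    refine ⟨eg_comm hX (by decide) (by decide) (by decide) (by decide) _ hv1, ?_⟩
    have := eg_col hX hz0 (i := 0) (j := 1) (k := 2) (by decide) (by decide) (by decide) c hv1' hv1
    simpa [mem_Es] using this
  obtain ⟨γ, v2, hv2, hv20⟩ := find_eg hX hn hz (i := 1) (j := 0) (by decide)
    (hXn 1 0 (by decide)) V1 (by
      rintro w ⟨h1, h2⟩
      refine ⟨?_, eg_comm hX (by decide) (by decide) (by decide) (by decide) _ h2⟩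
      have := eg_col hX hz0 (i := 1) (j := 0) (k := 2) (by decide) (by decide) (by decide) 1 h1 h2
      simpa [mem_Es] using this) ⟨_, b1, hX.ne_zero (by decide) c hv10⟩
  obtain ⟨δ, v3, hv3, hv30⟩ := find_eg hX hn hz (i := 1) (j := 3) (by decide)
    (hXn 1 3 (by decide)) (V1 ⊓ Es X z 1 0 γ) (by
      rintro w ⟨⟨h1, h2⟩, h3⟩
      exact ⟨⟨eg_comm hX (by decide) (by decide) (by decide) (by decide) _ h1,
        eg_comm hX (by decide) (by decide) (by decide) (by decide) _ h2⟩,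
        eg_comm hX (by decide) (by decide) (by decide) (by decide) _ h3⟩) ⟨_, hv2, hv20⟩
  obtain ⟨β, v4, hv4, hv40⟩ := find_eg hX hn hz (i := 3) (j := 2) (by decide)
    (hXn 3 2 (by decide)) (V1 ⊓ Es X z 1 0 γ ⊓ Es X z 1 3 δ) (by
      rintro w ⟨⟨⟨h1, h2⟩, h3⟩, h4⟩
      refine ⟨⟨⟨eg_comm hX (by decide) (by decide) (by decide) (by decide) _ h1,
        eg_comm hX (by decide) (by decide) (by decide) (by decide) _ h2⟩,
        eg_comm hX (by decide) (by decide) (by decide) (by decide) _ h3⟩, ?_⟩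
      have := eg_row hX hz0 (i := 3) (j := 2) (k := 1) (by decide) (by decide) (by decide) 1 h4 h2
      simpa [mem_Es] using this) ⟨_, hv3, hv30⟩
  obtain ⟨⟨⟨⟨q1, q2⟩, q3⟩, q4⟩, q5⟩ := hv4
  let St : ℤ → ℤ → ℤ → ℤ → Prop := fun α β γ δ => ∃ v, v ≠ 0 ∧ Eg X z 0 2 α v ∧ Eg X z 1 2 0 v ∧
    Eg X z 3 2 β v ∧ Eg X z 1 0 γ v ∧ Eg X z 1 3 δ v
  have m1 : ∀ α β γ δ, St α β γ δ → ∀ s, St α (β - s * α) (γ + s * δ) δ := by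
    rintro α β γ δ ⟨v, h0, h1, h2, h3, h4, h5⟩ s
    exact ⟨X 0 3 s v, hX.ne_zero (by decide) _ h0,
      eg_comm hX (by decide) (by decide) (by decide) (by decide) _ h1,
      eg_comm hX (by decide) (by decide) (by decide) (by decide) _ h2,
      eg_col hX hz0 (by decide) (by decide) (by decide) s h3 h1,
      eg_row hX hz0 (by decide) (by decide) (by decide) s h4 h5,
      eg_comm hX (by decide) (by decide) (by decide) (by decide) _ h5⟩
  have m2 : ∀ α β γ δ, St α β γ δ → ∀ s, St (α - s * β) β γ (δ + s * γ) := by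
    rintro α β γ δ ⟨v, h0, h1, h2, h3, h4, h5⟩ s
    exact ⟨X 3 0 s v, hX.ne_zero (by decide) _ h0,
      eg_col hX hz0 (by decide) (by decide) (by decide) s h1 h3,
      eg_comm hX (by decide) (by decide) (by decide) (by decide) _ h2,
      eg_comm hX (by decide) (by decide) (by decide) (by decide) _ h3,
      eg_comm hX (by decide) (by decide) (by decide) (by decide) _ h4,
      eg_row hX hz0 (by decide) (by decide) (by decide) s h5 h4⟩
  have s1 : St 1 β γ δ := ⟨v4, hv40, q1, q2, q5, q3, q4⟩
  have s2 := m1 _ _ _ _ s1 β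
  obtain ⟨s, t, hst⟩ := stable_range n hn (γ + β * δ) δ
  have s3 := m2 _ _ _ _ s2 s
  have s4 := m1 _ _ _ _ s3 t
  obtain ⟨w, h0, h1, h2, h3, h4, h5⟩ := s4
  refine ⟨w, h0, ?_, h2, eg_congr hz ?_ h4 hn⟩
  · have e : (1 : ℤ) - s * (β - β * 1) = 1 := by ring
    rwa [e] at h1
  · simpa using hst
end

theorem Stein.one_of_dvd {M : Type*} [Monoid M] {x : Fin 4 → Fin 4 → ℤ → M} (hx : Stein x)
    {i j : Fin 4} (hij : i ≠ j) {n : ℤ} (h : x i j n = 1) {a : ℤ} (ha : n ∣ a) : x i j a = 1 := by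
  obtain ⟨k, rfl⟩ := ha
  exact hx.mul_eq_one hij h k

theorem idem_comm1 {M : Type*} [Monoid M] {x : Fin 4 → Fin 4 → ℤ → M} (hx : Stein x) {n : ℤ}
    (h : ∀ i j, i ≠ j → x i j n = 1) {i j k l : Fin 4} (hij : i ≠ j) (hkl : k ≠ l)
    (hop : ¬ (j = k ∧ i = l)) {a b : ℤ} (hab : n ∣ a * b) : Commute (x i j a) (x k l b) := by
  by_cases hjk : j = k
  · subst hjk
    have hil : i ≠ l := fun e => hop ⟨rfl, e⟩
    have := hx.br i j l hij hkl hil a b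
    rw [hx.one_of_dvd hil (h i l hil) hab, one_mul] at this
    exact this
  · by_cases hil : i = l
    · subst hil
      have hkj : k ≠ j := fun e => hjk e.symm
      have := hx.br k i j hkl hij hkj b a
      rw [hx.one_of_dvd hkj (h k j hkj) (by rwa [mul_comm]), one_mul] at this
      exact this.symm
    · exact hx.comm i j k l hij hkl hjk hil a b

theorem idem_comm {M : Type*} [Monoid M] {x : Fin 4 → Fin 4 → ℤ → M} (hx : Stein x) {n : ℤ}
    (h : ∀ i j, i ≠ j → x i j n = 1) {e f : ℤ} (hef : n ∣ e * f) (hee : n ∣ e * e - e)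
    {i j k l : Fin 4} (hij : i ≠ j) (hkl : k ≠ l) (a b : ℤ) :
    Commute (x i j (f * a)) (x k l (e * b)) := by
  have hd : ∀ a b : ℤ, n ∣ f * a * (e * b) := by
    intro a b
    have := hef.mul_right (a * b)
    have e1 : e * f * (a * b) = f * a * (e * b) := by ring
    rwa [e1] at this
  by_cases hop : j = k ∧ i = l
  · obtain ⟨rfl, rfl⟩ := hop
    obtain ⟨m, hjm, hmi⟩ := third j i
    have e1 : x j i (e * b) = x j m (e * b) * x m i (e * 1) * x j m (-(e * b)) * x m i (-(e * 1)) := by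
      rw [hx.br j m i hjm hmi hkl, mul_assoc (x j i _ * _), ← hx.add j m hjm, add_neg_cancel,
        hx.zero j m hjm, mul_one, mul_assoc, ← hx.add m i hmi, add_neg_cancel,
        hx.zero m i hmi, mul_one]
      apply hx.periodic hkl (h j i hkl)
      have := (hee.mul_right b)
      have e2 : (e * e - e) * b = -(e * b - e * b * (e * 1)) := by ring
      rw [e2] at this
      exact (dvd_neg).1 this
    rw [e1, ← mul_neg, ← mul_neg]
    have c1 : ∀ c, Commute (x i j (f * a)) (x j m (e * c)) := fun c =>
      idem_comm1 hx h hij hjm (fun hh => hmi hh.2.symm) (hd _ _)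
    have c2 : ∀ c, Commute (x i j (f * a)) (x m i (e * c)) := fun c =>
      idem_comm1 hx h hij hmi (fun hh => hjm hh.1) (hd _ _)
    exact (((c1 _).mul_right (c2 _)).mul_right (c1 _)).mul_right (c2 _)
  · exact idem_comm1 hx h hij hkl hop (hd _ _)

section
variable {V : Type*} [NormedAddCommGroup V] [InnerProductSpace ℂ V] [FiniteDimensional ℂ V]
  {X : Fin 4 → Fin 4 → ℤ → Module.End ℂ V}

theorem prime_step (hX : Stein X)
    (hiso : ∀ i j a x y, inner ℂ (X i j a x) (X i j a y) = inner ℂ x y)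
    {n : ℕ} (hXn : ∀ i j, i ≠ j → X i j n = 1)
    {m : ℕ} (hm : 0 < m)
    (hmin : ∀ Z : Submodule ℂ V, (∀ i j, i ≠ j → ∀ a, ∀ w ∈ Z, X i j a w ∈ Z) →
      (∀ i j, i ≠ j → ∀ w ∈ Z, X i j m w = w) → Z = ⊥)
    {e f : ℤ} (hef : (n : ℤ) ∣ e * f) (h1 : e + f = 1) (hfm : (n : ℤ) ∣ f * m)
    (l : ℂ) (v : V) (hv : v ≠ 0) (hvl : X 0 2 f v = l • v) :
    ∃ (r : ℂ) (w : V), w ≠ 0 ∧ X 0 2 f w = l • w ∧ X 0 2 e w = r • w ∧ r ^ m ≠ 1 := by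
  have hee : (n : ℤ) ∣ e * e - e := by
    have : e * e - e = -(e * f) := by linear_combination e * h1
    rw [this]; exact (dvd_neg).2 hef
  have hcomm : ∀ {i j k l : Fin 4}, i ≠ j → k ≠ l → ∀ a b : ℤ,
      Commute (X i j (f * a)) (X k l (e * b)) := fun hij hkl a b =>
    idem_comm hX hXn hef hee hij hkl a b
  have hXm : ∀ i j, i ≠ j → X i j (e * m) = X i j m := by
    intro i j hij
    apply hX.periodic hij (hXn i j hij)
    have : e * (m : ℤ) - m = -(f * m) := by linear_combination m * h1
    rw [this]; exact (dvd_neg).2 hfm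
  have hXm2 : ∀ i j, i ≠ j → X i j (e * m * e) = X i j m := by
    intro i j hij
    rw [← hXm i j hij]
    apply hX.periodic hij (hXn i j hij)
    have : e * m * e - e * m = (e * e - e) * m := by ring
    rw [this]; exact hee.mul_right _
  let Y : Submodule ℂ V := Module.End.eigenspace (X 0 2 f) l
  have hY : ∀ w, w ∈ Y ↔ X 0 2 f w = l • w := fun w => Module.End.mem_eigenspace_iff
  have hYinv : ∀ i j, i ≠ j → ∀ a, ∀ w ∈ Y, X i j (e * a) w ∈ Y := by
    intro i j hij a w hw
    rw [hY] at hw ⊢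
    have := hcomm (i := 0) (j := 2) (by decide) hij 1 a
    rw [mul_one] at this
    rw [← Module.End.mul_apply, this.eq, Module.End.mul_apply, hw, map_smul]
  by_contra hcon
  push Not at hcon
  have t02 : ∀ w ∈ Y, X 0 2 m w = w := by
    have := lemD (X 0 2 e) (hiso 0 2 e) Y (fun w hw => by simpa using hYinv 0 2 (by decide) 1 w hw)
      m hm (fun r w hw hw0 hr => hcon r w hw0 ((hY w).1 hw) hr)
    rw [hX.pow (by decide), hXm 0 2 (by decide)] at this
    exact this
  have trow : ∀ i j k, i ≠ j → j ≠ k → i ≠ k → (∀ w ∈ Y, X i j m w = w) →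
      ∀ w ∈ Y, X i k m w = w := by
    intro i j k hij hjk hik h w hw
    have b := hX.br i j k hij hjk hik (e * m) (e * 1)
    rw [hXm i j hij, mul_one, hXm2 i k hik] at b
    have b' := congrArg (fun T : Module.End ℂ V => T (X j k (-e) w)) b
    simp only [Module.End.mul_apply] at b'
    have hw' : X j k (-e) w ∈ Y := by simpa using hYinv j k hjk (-1) w hw
    rw [h _ hw'] at b'
    have hc : X j k e (X j k (-e) w) = w := by simpa using hX.inv_apply hjk (-e) w
    rw [hc, h w hw] at b'
    exact b'.symm
  have tcol : ∀ i j k, i ≠ j → j ≠ k → i ≠ k → (∀ w ∈ Y, X j k m w = w) →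
      ∀ w ∈ Y, X i k m w = w := by
    intro i j k hij hjk hik h w hw
    have b := hX.br i j k hij hjk hik (e * 1) (e * m)
    rw [mul_one, mul_comm e (e * m), hXm j k hjk, hXm2 i k hik] at b
    have b' := congrArg (fun T : Module.End ℂ V => T (X i j (-e) w)) b
    simp only [Module.End.mul_apply] at b'
    have hw' : X i j (-e) w ∈ Y := by simpa using hYinv i j hij (-1) w hw
    have hc : X i j e (X i j (-e) w) = w := by simpa using hX.inv_apply hij (-e) w
    rw [h _ hw', hc, h w hw] at b'
    exact b'.symm
  have tall : ∀ i j, i ≠ j → ∀ w ∈ Y, X i j m w = w := by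
    have t0 : ∀ k, k ≠ 0 → ∀ w ∈ Y, X 0 k m w = w := by
      intro k hk
      by_cases h2 : k = 2
      · subst h2; exact t02
      · exact trow 0 2 k (by decide) (Ne.symm h2) hk.symm t02
    have t1 : ∀ i k, i ≠ k → k ≠ 0 → ∀ w ∈ Y, X i k m w = w := by
      intro i k hik hk
      by_cases h2 : i = 0
      · subst h2; exact t0 k hk
      · exact tcol i 0 k h2 hk.symm hik (t0 k hk)
    intro i k hik
    by_cases hk : k = 0
    · subst hk
      obtain ⟨j, hj, hj0⟩ := third i 0
      exact trow i j 0 hj hj0 hik (t1 i j hj hj0)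
    · exact t1 i k hik hk
  let A : Submonoid (Module.End ℂ V) :=
    Submonoid.closure {T | ∃ i j a, i ≠ j ∧ T = X i j (e * a)}
  have hAY : ∀ T ∈ A, ∀ w ∈ Y, T w ∈ Y := by
    intro T hT
    induction hT using Submonoid.closure_induction with
    | mem T hT =>
      obtain ⟨i, j, a, hij, rfl⟩ := hT
      exact hYinv i j hij a
    | one => intro w hw; exact hw
    | mul S T _ _ hS hT => intro w hw; exact hS _ (hT _ hw)
  have hAc : ∀ T ∈ A, ∀ i j, i ≠ j → ∀ a, Commute (X i j (f * a)) T := by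
    intro T hT i j hij a
    induction hT using Submonoid.closure_induction with
    | mem T hT =>
      obtain ⟨k, l, b, hkl, rfl⟩ := hT
      exact hcomm hij hkl a b
    | one => exact Commute.one_right _
    | mul S T _ _ hS hT => exact hS.mul_right hT
  let Z : Submodule ℂ V :=
    { carrier := {w | ∀ T ∈ A, ∀ i j, i ≠ j → X i j m (T w) = T w}
      zero_mem' := by intro T hT i j hij; simp
      add_mem' := by
        intro x y hx hy T hT i j hij
        rw [map_add, map_add, hx T hT i j hij, hy T hT i j hij]
      smul_mem' := by
        intro c x hx T hT i j hij
        rw [map_smul, map_smul, hx T hT i j hij] }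
  have hZ := hmin Z (by
    intro i j hij a w hw
    have h2 : X i j a w = X i j (e * a) (X i j (f * a) w) := by
      rw [← Module.End.mul_apply, ← hX.add i j hij, ← add_mul, h1, one_mul]
    rw [h2]
    intro T hT k l hkl
    have hTA : T * X i j (e * a) ∈ A :=
      A.mul_mem hT (Submonoid.subset_closure ⟨i, j, a, hij, rfl⟩)
    rw [← Module.End.mul_apply T, ← Module.End.mul_apply (T * _), ← (hAc _ hTA i j hij a).eq,
      Module.End.mul_apply (X i j (f * a)), ← Module.End.mul_apply (X k l m), ← hXm k l hkl,
      ← (hcomm hij hkl a m).eq, hXm k l hkl, Module.End.mul_apply, hw _ hTA k l hkl]) (by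
    intro i j hij w hw
    exact hw 1 A.one_mem i j hij)
  have hvZ : v ∈ Z := fun T hT i j hij => tall i j hij _ (hAY T hT v ((hY v).2 hvl))
  rw [hZ, Submodule.mem_bot] at hvZ
  exact hv hvZ

theorem eig_pow_one (hX : Stein X) {i j : Fin 4} (hij : i ≠ j) {a : ℤ} {k : ℕ} (h : X i j (a * k) = 1)
    {l : ℂ} {v : V} (hv : v ≠ 0) (e : X i j a v = l • v) : l ^ k = 1 := by
  have := pow_eig e k
  rw [hX.pow hij, h, Module.End.one_apply] at this
  have h2 : (l ^ k - 1) • v = 0 := by rw [sub_smul, ← this, one_smul, sub_self]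
  rcases smul_eq_zero.1 h2 with h | h
  · exact sub_eq_zero.1 h
  · exact absurd h hv

theorem prim_eig [Nontrivial V] (hX : Stein X)
    (hiso : ∀ i j a x y, inner ℂ (X i j a x) (X i j a y) = inner ℂ x y)
    {n : ℕ} (hn : 0 < n) (hXn : ∀ i j, i ≠ j → X i j n = 1)
    (hmin : ∀ m : ℕ, 0 < m → m < n → ∀ Z : Submodule ℂ V,
      (∀ i j, i ≠ j → ∀ a, ∀ w ∈ Z, X i j a w ∈ Z) →
      (∀ i j, i ≠ j → ∀ w ∈ Z, X i j m w = w) → Z = ⊥) :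
    ∃ (z : ℂ) (v : V), IsPrimitiveRoot z n ∧ v ≠ 0 ∧ X 0 2 1 v = z • v := by
  have n02 : (0 : Fin 4) ≠ 2 := by decide
  have key : ∀ S : Finset ℕ, S ⊆ n.primeFactors → ∃ (l : ℂ) (v : V), v ≠ 0 ∧ X 0 2 1 v = l • v ∧
      ∀ p ∈ S, l ^ (n / p) ≠ 1 := by
    intro S
    induction S using Finset.induction_on with
    | empty =>
      intro _
      obtain ⟨l, w, -, h0, h⟩ := exists_eig (X 0 2 1) ⊤ (fun _ _ => trivial) top_ne_bot
      exact ⟨l, w, h0, h, by simp⟩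
    | insert q S hq ih =>
      intro hS
      obtain ⟨l, v, hv, hl, hlS⟩ := ih ((Finset.subset_insert q S).trans hS)
      have hqn := hS (Finset.mem_insert_self q S)
      rw [Nat.mem_primeFactors] at hqn
      obtain ⟨qp, qn, -⟩ := hqn
      have hln : l ^ n = 1 := eig_pow_one hX n02 (by rw [one_mul]; exact hXn 0 2 n02) hv hl
      have hl0 : l ≠ 0 := by
        rintro rfl
        rw [zero_pow hn.ne'] at hln
        exact zero_ne_one hln
      have hprod : q ^ n.factorization q * (n / q ^ n.factorization q) = n :=
        Nat.ordProj_mul_ordCompl_eq_self n q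
      have hcop : Nat.Coprime (q ^ n.factorization q) (n / q ^ n.factorization q) :=
        (Nat.coprime_ordCompl qp hn.ne').pow_left _
      have hqd : q ∣ q ^ n.factorization q :=
        dvd_pow_self q (qp.factorization_pos_of_dvd hn.ne' qn).ne'
      have hQp : ∀ p : ℕ, p.Prime → p ∣ q ^ n.factorization q → p = q := fun p pp h =>
        (Nat.prime_dvd_prime_iff_eq pp qp).1 (pp.dvd_of_dvd_pow h)
      generalize q ^ n.factorization q = Q at hprod hcop hqd hQp
      generalize n / Q = c at hprod hcop
      obtain ⟨u, w, huw⟩ := Nat.isCoprime_iff_coprime.2 hcop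
      obtain ⟨e, he⟩ : ∃ e, e = w * (c : ℤ) := ⟨_, rfl⟩
      obtain ⟨f, hf⟩ : ∃ f, f = u * (Q : ℤ) := ⟨_, rfl⟩
      have hprod' : (Q : ℤ) * c = n := by exact_mod_cast hprod
      have h1 : e + f = 1 := by rw [he, hf]; linear_combination huw
      have hef : (n : ℤ) ∣ e * f := ⟨w * u, by rw [he, hf, ← hprod']; ring⟩
      have hdiv : ∀ p : ℕ, p ∣ n → ∀ g : ℤ, (p : ℤ) ∣ g → (n : ℤ) ∣ g * (n / p : ℕ) := by
        rintro p ⟨k, hk⟩ g ⟨t, rfl⟩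
        have hp : 0 < p := Nat.pos_of_ne_zero (by rintro rfl; omega)
        rw [hk, Nat.mul_div_cancel_left _ hp]
        exact ⟨t, by push_cast; ring⟩
      have hqf : (q : ℤ) ∣ f := by
        rw [hf]; exact (Int.natCast_dvd_natCast.2 hqd).mul_left u
      have hall : ∀ a, X 0 2 a v = l ^ a • v := by
        intro a
        have := hX.eg_of_one (c := 1) n02 hl0 (by rw [zpow_one]; exact hl) a
        rwa [one_mul] at this
      obtain ⟨r, v', hv', k1, k2, k3⟩ := prime_step hX hiso hXn (m := n / q)
        (Nat.div_pos (Nat.le_of_dvd hn qn) qp.pos)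
        (hmin _ (Nat.div_pos (Nat.le_of_dvd hn qn) qp.pos) (Nat.div_lt_self hn qp.one_lt))
        hef h1 (hdiv q qn f hqf) (l ^ f) v hv (hall f)
      have hlz : ∀ g : ℤ, (n : ℤ) ∣ g → l ^ g = 1 := by
        rintro g ⟨t, rfl⟩
        rw [_root_.zpow_mul, zpow_natCast, hln, _root_.one_zpow]
      refine ⟨l ^ f * r, v', hv', ?_, ?_⟩
      · rw [← h1, add_comm e f, hX.add 0 2 n02, Module.End.mul_apply, k2, map_smul, k1, smul_smul, mul_comm]
      · intro p hp
        rw [mul_pow, ← zpow_natCast (l ^ f), ← _root_.zpow_mul]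
        rcases Finset.mem_insert.1 hp with rfl | hpS
        · rw [hlz _ (hdiv p qn f hqf), one_mul]
          exact k3
        · have hpn := hS hp
          rw [Nat.mem_primeFactors] at hpn
          obtain ⟨pp, pn, -⟩ := hpn
          have hpq : p ≠ q := by rintro rfl; exact hq hpS
          have hpe : (p : ℤ) ∣ e := by
            rw [he]
            apply Dvd.dvd.mul_left
            rw [Int.natCast_dvd_natCast]
            have := pn
            rw [← hprod] at this
            rcases pp.dvd_mul.1 this with h | h
            · exact absurd (hQp p pp h) hpq
            · exact h
          have hen := hdiv p pn e hpe
          rw [eig_pow_one hX n02 (hX.one_of_dvd n02 (hXn 0 2 n02) hen) hv' k2, mul_one]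
          have e1 : f * ((n / p : ℕ) : ℤ) = ((n / p : ℕ) : ℤ) + -(e * (n / p : ℕ)) := by
            linear_combination ((n / p : ℕ) : ℤ) * h1
          rw [e1, zpow_add₀ hl0, hlz _ ((dvd_neg).2 hen), mul_one, zpow_natCast]
          exact hlS p hpS
  obtain ⟨l, v, hv, hl, h⟩ := key _ subset_rfl
  refine ⟨l, v, ?_, hv, hl⟩
  rw [IsPrimitiveRoot.iff_orderOf]
  apply orderOf_eq_of_pow_and_pow_div_prime hn
  · exact eig_pow_one hX n02 (by rw [one_mul]; exact hXn 0 2 n02) hv hl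
  · intro p pp pn
    exact h p (Nat.mem_primeFactors.2 ⟨pp, pn, hn.ne'⟩)
end

theorem inner_eig {V : Type*} [NormedAddCommGroup V] [InnerProductSpace ℂ V]
    (T : Module.End ℂ V) (hT : ∀ x y, inner ℂ (T x) (T y) = inner ℂ x y) {w : V} (hw : w ≠ 0)
    {l : ℂ} (h : T w = l • w) (y : V) : inner ℂ w (T y) = l * inner ℂ w y := by
  have h1 := hT w w
  have h2 := hT w y
  rw [h, inner_smul_left] at h1 h2
  rw [inner_smul_right] at h1
  have h3 : inner ℂ w w ≠ 0 := fun h => hw (inner_self_eq_zero.1 h)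
  have h4 : (starRingEnd ℂ) l * l = 1 := by
    apply mul_right_cancel₀ h3
    rw [mul_assoc, h1, one_mul]
  rw [← h2]
  linear_combination -(inner ℂ w (T y)) * h4

theorem final_F {F : Type*} [NormedAddCommGroup F] [InnerProductSpace ℂ F] [FiniteDimensional ℂ F]
    [Nontrivial F] (ρ : El →* Module.End ℂ F)
    (hiso : ∀ g x y, inner ℂ (ρ g x) (ρ g y) = inner ℂ x y)
    {n : ℕ} (hn : 0 < n) (hXn : ∀ i j, i ≠ j → ρ (xe i j n) = 1)
    (hmin : ∀ m : ℕ, 0 < m → m < n → ∀ Z : Submodule ℂ F,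
      (∀ i j, i ≠ j → ∀ a, ∀ w ∈ Z, ρ (xe i j a) w ∈ Z) →
      (∀ i j, i ≠ j → ∀ w ∈ Z, ρ (xe i j m) w = w) → Z = ⊥) :
    ∃ v : F, v ≠ 0 ∧ ∀ g, ρ (ie g) v = v := by
  have hX : Stein (fun i j a => ρ (xe i j a)) := xe_stein.map ρ
  obtain ⟨z, v, hz, hv, hv2⟩ := prim_eig hX (fun i j a => hiso _) hn hXn hmin
  obtain ⟨w, hw, w02, w12, w10⟩ := localL hX hn hz hXn v hv hv2
  simp only [Eg, one_mul, zero_mul, zpow_zero, one_smul] at w02 w12 w10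
  have hcsp : ∀ g, Cong1 n g → ρ (ie g) = 1 := by
    intro g hg
    have := csp_main ρ.toHomUnits n (fun i j hij => Units.ext (hXn i j hij)) hn g hg
    exact congrArg Units.val this
  have hzc : ∀ a : ℤ, z ^ a = 1 → (n : ℤ) ∣ a := fun a h => (hz.zpow_eq_one_iff_dvd a).1 h
  have dich : ∀ g, inner ℂ w (ρ (ie g) w) ≠ 0 → ρ (ie g) w = w := by
    intro g hg
    have e1 := congrArg (fun x => ρ x w) (ie_conj02 g 1)
    have e2 := congrArg (fun x => ρ x w) (ie_conj12 g 1)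
    simp only [map_mul, Module.End.mul_apply, mul_one] at e1 e2
    have w02' := w02 1
    rw [zpow_one] at w02'
    rw [w02', map_smul] at e1
    rw [w12] at e2
    have f1 := congrArg (fun y => inner ℂ w y) e1
    have f2 := congrArg (fun y => inner ℂ w y) e2
    have g12 : ∀ (a : ℤ) (y : F), inner ℂ w (ρ (xe 1 2 a) y) = inner ℂ w y := by
      intro a y
      have := inner_eig (ρ (xe 1 2 a)) (hiso _) hw (l := 1) (by rw [w12, one_smul]) y
      rwa [one_mul] at this
    rw [inner_eig _ (hiso _) hw (w02 _), g12, inner_smul_right] at f1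
    rw [inner_eig _ (hiso _) hw (w02 _), g12] at f2
    have hz0 := hz.ne_zero hn.ne'
    have ha : (n : ℤ) ∣ g 0 0 - 1 := by
      apply hzc
      rw [zpow_sub₀ hz0, ← mul_right_cancel₀ hg f1, zpow_one, div_self hz0]
    have hb : (n : ℤ) ∣ g 0 1 := by
      apply hzc
      apply mul_right_cancel₀ hg
      rw [← f2, one_mul]
    have e : g = lo (g 1 0) * (lo (-(g 1 0)) * g) := by
      rw [← mul_assoc]
      have : lo (g 1 0) * lo (-(g 1 0)) = 1 := by
        ext i j
        fin_cases i <;> fin_cases j <;> simp [sl2_mul, lo_apply]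
      rw [this, one_mul]
    have hc : Cong1 n (lo (-(g 1 0)) * g) := by
      have d := det2 g
      obtain ⟨p, hp⟩ := ha
      obtain ⟨r, hr⟩ := hb
      have x00 : (lo (-(g 1 0)) * g) 0 0 = g 0 0 := by simp [sl2_mul, lo_apply]
      have x01 : (lo (-(g 1 0)) * g) 0 1 = g 0 1 := by simp [sl2_mul, lo_apply]
      have x10 : (lo (-(g 1 0)) * g) 1 0 = -(g 1 0) * g 0 0 + g 1 0 := by simp [sl2_mul, lo_apply]
      have x11 : (lo (-(g 1 0)) * g) 1 1 = -(g 1 0) * g 0 1 + g 1 1 := by simp [sl2_mul, lo_apply]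
      refine ⟨⟨p, ?_⟩, ⟨r, ?_⟩, ⟨-(g 1 0) * p, ?_⟩, ⟨-p * g 1 1, ?_⟩⟩
      · rw [x00, hp]
      · rw [x01, hr]
      · rw [x10]; linear_combination -(g 1 0) * hp
      · rw [x11]; linear_combination d - g 1 1 * hp
    rw [e, map_mul, map_mul, hcsp _ hc, mul_one, ie_lo]
    exact w10 _
  have hdich2 : ∀ g1 g2, inner ℂ (ρ (ie g1) w) (ρ (ie g2) w) ≠ 0 → ρ (ie g1) w = ρ (ie g2) w := by
    intro g1 g2 h
    have e : ρ (ie g2) w = ρ (ie g1) (ρ (ie (g1⁻¹ * g2)) w) := by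
      rw [← Module.End.mul_apply, ← map_mul, ← map_mul, mul_inv_cancel_left]
    rw [e, hiso] at h
    rw [e, dich _ h]
  have hne : ∀ g, ρ (ie g) w ≠ 0 := by
    intro g h
    have := hiso (ie g) w w
    rw [h, inner_zero_left] at this
    exact hw (inner_self_eq_zero.1 this.symm)
  let O : Set F := Set.range (fun g => ρ (ie g) w)
  have hO : O.Finite := by
    apply LinearIndependent.setFinite (R := ℂ)
    apply linearIndependent_of_ne_zero_of_inner_eq_zero
    · rintro ⟨x, g, rfl⟩
      exact hne g
    · rintro ⟨x, g1, rfl⟩ ⟨y, g2, rfl⟩ hxy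
      by_contra hcon
      exact hxy (Subtype.ext (hdich2 g1 g2 hcon))
  have hwO : w ∈ O := ⟨1, by simp⟩
  refine ⟨∑ x ∈ hO.toFinset, x, ?_, ?_⟩
  · intro h0
    have h1 := congrArg (fun y => inner ℂ w y) h0
    simp only [inner_sum, inner_zero_right] at h1
    rw [Finset.sum_eq_single_of_mem w (hO.mem_toFinset.2 hwO)] at h1
    · exact hw (inner_self_eq_zero.1 h1)
    · intro x hx hxw
      obtain ⟨g, rfl⟩ := hO.mem_toFinset.1 hx
      by_contra hcon
      exact hxw (dich g hcon)
  · intro g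
    rw [map_sum]
    have hmaps : ∀ g, ∀ x ∈ hO.toFinset, ρ (ie g) x ∈ hO.toFinset := by
      intro g x hx
      obtain ⟨g', rfl⟩ := hO.mem_toFinset.1 hx
      rw [hO.mem_toFinset]
      exact ⟨g * g', by simp [map_mul]⟩
    refine Finset.sum_bij' (fun x _ => ρ (ie g) x) (fun x _ => ρ (ie g⁻¹) x)
      (hmaps g) (hmaps g⁻¹) ?_ ?_ (fun _ _ => rfl)
    · intro x _
      rw [← Module.End.mul_apply, ← map_mul, ← map_mul]; simp
    · intro x _
      rw [← Module.End.mul_apply, ← map_mul, ← map_mul]; simp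

theorem main_V {V : Type*} [NormedAddCommGroup V] [InnerProductSpace ℂ V] [FiniteDimensional ℂ V]
    [Nontrivial V] (ρ : El →* Module.End ℂ V)
    (hiso : ∀ g x y, inner ℂ (ρ g x) (ρ g y) = inner ℂ x y) :
    ∃ v : V, v ≠ 0 ∧ ∀ g, ρ (ie g) v = v := by
  classical
  have hX : Stein (fun i j a => ρ (xe i j a)) := xe_stein.map ρ
  let P : ℕ → Prop := fun n => 0 < n ∧ ∃ Z : Submodule ℂ V, Z ≠ ⊥ ∧
    (∀ i j, i ≠ j → ∀ a, ∀ w ∈ Z, ρ (xe i j a) w ∈ Z) ∧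
    (∀ i j, i ≠ j → ∀ w ∈ Z, ρ (xe i j n) w = w)
  have hP : ∃ n, P n := by
    refine ⟨(Module.finrank ℂ V).factorial, Nat.factorial_pos _, ⊤, top_ne_bot,
      fun _ _ _ _ _ _ => trivial, ?_⟩
    intro i j hij w _
    have := finite_order hX (fun i j a => hiso _) i j hij
    rw [this, Module.End.one_apply]
  obtain ⟨n, ⟨hn, F, hF, hinv, hfix⟩, hminN⟩ : ∃ n, P n ∧ ∀ m, m < n → ¬ P m :=
    ⟨Nat.find hP, Nat.find_spec hP, fun m hm => Nat.find_min hP hm⟩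
  have hFg : ∀ g, (∀ w ∈ F, ρ g w ∈ F) ∧ (∀ w ∈ F, ρ g⁻¹ w ∈ F) := by
    intro g
    have hg : g ∈ Subgroup.closure {g | ∃ i j a, i ≠ j ∧ g = xe i j a} := by
      rw [xe_closure]; trivial
    induction hg using Subgroup.closure_induction with
    | mem x hx =>
      obtain ⟨i, j, a, hij, rfl⟩ := hx
      have : (xe i j a)⁻¹ = xe i j (-a) := by
        rw [inv_eq_iff_mul_eq_one, ← xe_stein.add i j hij, add_neg_cancel, xe_stein.zero i j hij]
      rw [this]
      exact ⟨hinv i j hij a, hinv i j hij (-a)⟩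
    | one => simp
    | mul x y _ _ hx hy =>
      rw [_root_.mul_inv_rev, map_mul, map_mul]
      exact ⟨fun w hw => hx.1 _ (hy.1 _ hw), fun w hw => hy.2 _ (hx.2 _ hw)⟩
    | inv x _ hx =>
      rw [inv_inv]
      exact ⟨hx.2, hx.1⟩
  have : Nontrivial F := Submodule.nontrivial_iff_ne_bot.2 hF
  let ρF : El →* Module.End ℂ F :=
    { toFun := fun g => LinearMap.restrict (ρ g) (hFg g).1
      map_one' := by ext x; simp
      map_mul' := by intro g h; ext x; simp }
  have hρF : ∀ g (x : F), ((ρF g x : F) : V) = ρ g x := fun g x => rfl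
  obtain ⟨v, hv, h⟩ := final_F ρF (fun g x y => hiso g x y) hn
    (fun i j hij => by ext x; exact hfix i j hij x x.2) (by
      intro m hm hmn Z hZ1 hZ2
      by_contra hZ
      refine hminN m hmn ⟨hm, Z.map F.subtype, ?_, ?_, ?_⟩
      · intro h0
        apply hZ
        rw [Submodule.eq_bot_iff] at h0 ⊢
        intro x hx
        exact Subtype.ext (h0 _ ⟨x, hx, rfl⟩)
      · rintro i j hij a _ ⟨w, hw, rfl⟩
        exact ⟨ρF (xe i j a) w, hZ1 i j hij a w hw, rfl⟩
      · rintro i j hij _ ⟨w, hw, rfl⟩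
        exact congrArg Subtype.val (hZ2 i j hij w hw))
  exact ⟨v, fun h0 => hv (Subtype.ext h0), fun g => congrArg Subtype.val (h g)⟩

theorem stmt0 {V : Type*} [NormedAddCommGroup V] [InnerProductSpace ℂ V]
    [FiniteDimensional ℂ V] [Nontrivial V]
    (ρ : Matrix.SpecialLinearGroup (Fin 4) ℤ →* (V →L[ℂ] V))
    (hρ : ∀ g, ρ g ∈ unitary (V →L[ℂ] V)) :
    ∃ v : V, v ≠ 0 ∧ ∀ g : Matrix.SpecialLinearGroup (Fin 2) ℤ, ρ (iota g) v = v := by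
  let ρ' : El →* Module.End ℂ V :=
    { toFun := fun g => (ρ g.1).toLinearMap
      map_one' := by ext x; simp
      map_mul' := by intro g h; ext x; simp }
  obtain ⟨v, hv, h⟩ := main_V ρ' (by
    intro g x y
    show inner ℂ (ρ g.1 x) (ρ g.1 y) = inner ℂ x y
    have h1 := (Unitary.mem_iff.1 (hρ g.1)).1
    rw [← ContinuousLinearMap.adjoint_inner_right, ← ContinuousLinearMap.star_eq_adjoint,
      ← ContinuousLinearMap.mul_apply, h1, ContinuousLinearMap.one_apply])
  exact ⟨v, hv, fun g => h g⟩
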